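/- Fix δ with 1/2 < δ < 1 and set ε = 2δ − 1. There exist constants C > 0 and x₀ such that for every real x ≥ x₀ with x^ε > q and log x > 2·log m/(1−ε), the function W_x has a zero s with Re(s) > 1 and |s − (1 + 2(S₁ − 2·log m)/((2δ² − 1 − ε²)·(log x)²))| ≤ C/(log x)³. -/

import Mathlib

open Complex DirichletCharacter Finset

namespace WZero

open Filter Topology Asymptotics MeasureTheory

section CharacterSums

/-- The partial sums of a Dirichlet character are linear up to a bounded error. -/
lemma exists_norm_sum_sub_le {q : ℕ} [NeZero q] (χ : DirichletCharacter ℂ q) :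
    ∃ (c : ℂ) (B : ℝ), 0 ≤ B ∧ ∀ n : ℕ, ‖∑ k ∈ Icc 1 n, χ k - c * n‖ ≤ B := by
  have hq : (q : ℂ) ≠ 0 := Nat.cast_ne_zero.mpr (NeZero.ne q)
  set K : ℂ := ∑ k ∈ range q, χ ((k + 1 : ℕ) : ZMod q) with hK
  have hstep : ∀ n : ℕ, ∑ k ∈ range q, χ ((n + k + 1 : ℕ) : ZMod q) = K := by
    intro n
    induction n with
    | zero => simp [hK]
    | succ n ih =>
      rw [← ih]
      have h1 := Finset.sum_range_succ (fun k ↦ χ ((n + k + 1 : ℕ) : ZMod q)) q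
      have h2 := Finset.sum_range_succ' (fun k ↦ χ ((n + k + 1 : ℕ) : ZMod q)) q
      have h3 : χ ((n + q + 1 : ℕ) : ZMod q) = χ ((n + 0 + 1 : ℕ) : ZMod q) := by
        push_cast; simp
      rw [h1, h3] at h2
      have h4 := add_right_cancel h2
      rw [h4]
      refine Finset.sum_congr rfl fun k _ ↦ ?_
      congr 2; omega
  have hsum : ∀ n : ℕ, ∑ k ∈ Icc 1 n, χ (k : ZMod q) = ∑ k ∈ range n, χ ((k + 1 : ℕ) : ZMod q) := by
    intro n
    rw [Finset.range_eq_Ico, Finset.sum_Ico_add' (fun k : ℕ ↦ χ (k : ZMod q)) 0 n 1]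
    rfl
  let g : ℕ → ℂ := fun n ↦ ∑ k ∈ Icc 1 n, χ k - K / q * n
  have hper : Function.Periodic g q := by
    intro n
    simp only [g]
    rw [hsum, hsum, Finset.sum_range_add]
    have : ∑ x ∈ range q, χ ((n + x + 1 : ℕ) : ZMod q) = K := hstep n
    rw [this]
    push_cast
    field_simp
    ring
  refine ⟨K / q, ∑ n ∈ range q, ‖g n‖, by positivity, fun n ↦ ?_⟩
  have : g n = g (n % q) := (hper.map_mod_nat n).symm
  change ‖g n‖ ≤ _
  rw [this]
  exact Finset.single_le_sum (f := fun n ↦ ‖g n‖) (fun _ _ ↦ norm_nonneg _)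
    (Finset.mem_range.mpr (Nat.mod_lt _ (NeZero.pos q)))

/-- The Mellin transform of a bounded function supported on `(N, ∞)` is holomorphic in the left
half-plane. -/
lemma differentiableAt_mellin_neg {E : ℝ → ℂ} (hE : Measurable E) {M N : ℝ} (hN : 0 < N)
    (hM : ∀ t, ‖E t‖ ≤ M) (h0 : ∀ t ≤ N, E t = 0) {s : ℂ} (hs : 0 < s.re) :
    DifferentiableAt ℂ (fun s ↦ mellin E (-s)) s := by
  have h : DifferentiableAt ℂ (mellin E) (-s) := by
    refine mellin_differentiableAt_of_isBigO_rpow (a := 0) (b := -s.re - 1) ?_ ?_ (by simpa) ?_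
      (by simp)
    · refine LocallyIntegrable.locallyIntegrableOn ?_ _
      exact (locallyIntegrable_const (μ := volume) M).mono hE.aestronglyMeasurable
        (.of_forall fun t ↦ (hM t).trans (le_abs_self M))
    · simp only [neg_zero, Real.rpow_zero]
      exact isBigO_of_le' (c := M) _ fun t ↦ by simpa using hM t
    · refine (EventuallyEq.trans_isBigO ?_ (isBigO_zero _ _))
      filter_upwards [mem_nhdsWithin_of_mem_nhds (Iio_mem_nhds hN)] with t ht
      exact h0 t (le_of_lt ht)
  exact h.comp s differentiableAt_id.neg

lemma mellin_neg_eq_setIntegral {E : ℝ → ℂ} {N : ℝ} (hN : 0 < N) (h0 : ∀ t ≤ N, E t = 0) (s : ℂ) :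
    mellin E (-s) = ∫ t in Set.Ioi N, E t * (t : ℂ) ^ (-(s + 1)) := by
  rw [mellin, ← setIntegral_eq_of_subset_of_forall_sdiff_eq_zero measurableSet_Ioi
    (Set.Ioi_subset_Ioi hN.le) (s := Set.Ioi N)]
  · refine setIntegral_congr_fun measurableSet_Ioi fun t ht ↦ ?_
    simp only [smul_eq_mul]
    rw [mul_comm, neg_add']
  · intro t ht
    rw [h0 t (by simpa using ht.2)]; simp

lemma norm_mellin_neg_le {E : ℝ → ℂ} {M N : ℝ} (hN : 0 < N)
    (hM : ∀ t, ‖E t‖ ≤ M) (h0 : ∀ t ≤ N, E t = 0) {s : ℂ} (hs : 0 < s.re) :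
    ‖mellin E (-s)‖ ≤ M * (N ^ (-s.re) / s.re) := by
  rw [mellin_neg_eq_setIntegral hN h0]
  have h1 : ∫ t in Set.Ioi N, M * t ^ (-(s.re + 1)) = M * (N ^ (-s.re) / s.re) := by
    rw [integral_const_mul, integral_Ioi_rpow_of_lt (by linarith) hN]
    congr 1
    rw [show -(s.re + 1) + 1 = -s.re by ring, neg_div_neg_eq]
  rw [← h1]
  refine norm_integral_le_of_norm_le ?_ ?_
  · exact (integrableOn_Ioi_rpow_of_lt (by linarith) hN).const_mul M
  · refine (ae_restrict_iff' measurableSet_Ioi).mpr (.of_forall fun t ht ↦ ?_)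
    have ht0 : 0 < t := hN.trans ht
    rw [norm_mul, norm_cpow_eq_rpow_re_of_pos ht0]
    have : (-(s + 1)).re = -(s.re + 1) := by simp
    rw [this]
    exact mul_le_mul_of_nonneg_right (hM t) (by positivity)

end CharacterSums

section TruncatedSeries

/-- The partial sums of `χ` over `(N, t]`, minus their linear main term. -/
noncomputable def tailError {q : ℕ} (χ : DirichletCharacter ℂ q) (c : ℂ) (N : ℕ) (t : ℝ) : ℂ :=
  if t ≤ N then 0 else ∑ k ∈ Icc 1 ⌊t⌋₊, (if k ≤ N then 0 else χ k) - c * (t - N)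

lemma measurable_tailError {q : ℕ} (χ : DirichletCharacter ℂ q) (c : ℂ) (N : ℕ) :
    Measurable (tailError χ c N) := by
  refine Measurable.ite measurableSet_Iic measurable_const (Measurable.sub ?_ (by fun_prop))
  exact (measurable_from_nat (f := fun n ↦ ∑ k ∈ Icc 1 n, (if k ≤ N then 0 else χ k))).comp
    Nat.measurable_floor

lemma tailError_of_le {q : ℕ} (χ : DirichletCharacter ℂ q) (c : ℂ) (N : ℕ) (t : ℝ) (h : t ≤ N) :
    tailError χ c N t = 0 := if_pos h

lemma sum_Icc_ite_le {f : ℕ → ℂ} {N n : ℕ} (h : N ≤ n) :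
    ∑ k ∈ Icc 1 n, (if k ≤ N then 0 else f k) = ∑ k ∈ Icc 1 n, f k - ∑ k ∈ Icc 1 N, f k := by
  have h1 : ∑ k ∈ Icc 1 N, f k = ∑ k ∈ Icc 1 n, if k ≤ N then f k else 0 := by
    rw [← Finset.sum_filter]
    refine Finset.sum_congr ?_ fun _ _ ↦ rfl
    ext k; simp only [Finset.mem_Icc, Finset.mem_filter]; omega
  rw [h1, ← Finset.sum_sub_distrib]
  refine Finset.sum_congr rfl fun k _ ↦ ?_
  split_ifs <;> simp

lemma norm_tailError_le {q : ℕ} {χ : DirichletCharacter ℂ q} {c : ℂ} {B : ℝ} (hB : 0 ≤ B)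
    (h : ∀ n : ℕ, ‖∑ k ∈ Icc 1 n, χ k - c * n‖ ≤ B) (N : ℕ) (t : ℝ) :
    ‖tailError χ c N t‖ ≤ 2 * B + ‖c‖ := by
  unfold tailError
  split_ifs with ht
  · simp; positivity
  · push Not at ht
    have ht0 : 0 ≤ t := (Nat.cast_nonneg N).trans ht.le
    have hNt : N ≤ ⌊t⌋₊ := Nat.le_floor ht.le
    rw [sum_Icc_ite_le hNt]
    have e : ∑ k ∈ Icc 1 ⌊t⌋₊, χ k - ∑ k ∈ Icc 1 N, χ k - c * (t - N) =
      (∑ k ∈ Icc 1 ⌊t⌋₊, χ k - c * (⌊t⌋₊ : ℕ)) - (∑ k ∈ Icc 1 N, χ k - c * N)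
        + c * ((⌊t⌋₊ - t : ℝ) : ℂ) := by push_cast; ring
    rw [e]
    refine (norm_add_le _ _).trans ?_
    refine add_le_add ((norm_sub_le _ _).trans ?_) ?_
    · linarith [h ⌊t⌋₊, h N]
    · rw [norm_mul, norm_real, Real.norm_eq_abs]
      refine mul_le_of_le_one_right (norm_nonneg _) (abs_le.mpr ?_)
      constructor <;> linarith [Nat.floor_le ht0, Nat.lt_floor_add_one t]

lemma LSeries_truncated_eq {q : ℕ} [NeZero q] (χ : DirichletCharacter ℂ q) {c : ℂ} {B : ℝ} (hB : 0 ≤ B)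
    (h : ∀ n : ℕ, ‖∑ k ∈ Icc 1 n, χ k - c * n‖ ≤ B) {N : ℕ} (hN : 1 ≤ N) {s : ℂ} (hs : 1 < s.re) :
    LSeries (fun n ↦ if n ≤ N then 0 else χ n) s =
      c * (N : ℂ) ^ (1 - s) / (s - 1) + s * mellin (tailError χ c N) (-s) := by
  have hN0 : (0 : ℝ) < N := by exact_mod_cast hN
  have hN1 : (1 : ℝ) ≤ N := by exact_mod_cast hN
  have hs0 : s ≠ 0 := fun h ↦ by simp [h] at hs; linarith
  have hs1 : s - 1 ≠ 0 := fun h ↦ by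
    have : s = 1 := by linear_combination h
    simp [this] at hs
  rw [LSeries_eq_mul_integral' _ zero_le_one hs]
  swap
  · refine isBigO_of_le' (c := 1) _ fun n ↦ ?_
    rw [Real.norm_of_nonneg (by positivity), Real.norm_of_nonneg (by positivity), Real.rpow_one, one_mul]
    calc _ ≤ ∑ k ∈ Icc 1 n, (1 : ℝ) := Finset.sum_le_sum fun k _ ↦ by
          split_ifs
          · simp
          · exact χ.norm_le_one _
      _ = n := by simp
  set E := tailError χ c N with hE
  have hsplit : ∀ t : ℝ, N < t → (∑ k ∈ Icc 1 ⌊t⌋₊, (if k ≤ N then 0 else χ k)) * (t : ℂ) ^ (-(s + 1)) =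
      E t * (t : ℂ) ^ (-(s + 1)) + c * ((t : ℂ) ^ (-s) - N * (t : ℂ) ^ (-(s + 1))) := by
    intro t ht
    have ht0 : (t : ℂ) ≠ 0 := by
      have : t ≠ 0 := by linarith
      exact_mod_cast this
    rw [hE, tailError, if_neg (not_le.mpr ht)]
    have : (t : ℂ) ^ (-s) = t * (t : ℂ) ^ (-(s + 1)) := by
      nth_rw 2 [← cpow_one (t : ℂ)]
      rw [← cpow_add _ _ ht0]; congr 1; ring
    rw [this]; ring
  have hint : ∫ t in Set.Ioi (1 : ℝ), (∑ k ∈ Icc 1 ⌊t⌋₊, (if k ≤ N then 0 else χ k)) * (t : ℂ) ^ (-(s + 1))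
      = ∫ t in Set.Ioi (N : ℝ), (E t * (t : ℂ) ^ (-(s + 1)) + c * ((t : ℂ) ^ (-s) - N * (t : ℂ) ^ (-(s + 1)))) := by
    refine (setIntegral_eq_of_subset_of_forall_sdiff_eq_zero measurableSet_Ioi
      (Set.Ioi_subset_Ioi hN1) ?_).trans
      (setIntegral_congr_fun measurableSet_Ioi fun t ht ↦ hsplit t ht)
    · intro t ht
      have ht1 : t ≤ N := by simpa using ht.2
      rw [Finset.sum_eq_zero, zero_mul]
      intro k hk
      rw [if_pos]
      have := (Finset.mem_Icc.mp hk).2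
      have h2 := Nat.floor_le_floor ht1
      rw [Nat.floor_natCast] at h2
      omega
  have i1 : IntegrableOn (fun t : ℝ ↦ (t : ℂ) ^ (-(s + 1))) (Set.Ioi (N : ℝ)) :=
    integrableOn_Ioi_cpow_of_lt (by simp; linarith) hN0
  have i2 : IntegrableOn (fun t : ℝ ↦ (t : ℂ) ^ (-s)) (Set.Ioi (N : ℝ)) :=
    integrableOn_Ioi_cpow_of_lt (by simp; linarith) hN0
  have i3 : IntegrableOn (fun t : ℝ ↦ E t * (t : ℂ) ^ (-(s + 1))) (Set.Ioi (N : ℝ)) :=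
    i1.bdd_mul (measurable_tailError χ c N).aestronglyMeasurable
      (.of_forall fun t ↦ norm_tailError_le hB h N t)
  have i4 : IntegrableOn (fun t : ℝ ↦ (t : ℂ) ^ (-s) - N * (t : ℂ) ^ (-(s + 1))) (Set.Ioi (N : ℝ)) :=
    i2.sub (i1.const_mul _)
  rw [hint, integral_add i3 (i4.const_mul c), integral_const_mul,
    integral_sub i2 (i1.const_mul _), integral_const_mul, integral_Ioi_cpow_of_lt (by simp; linarith) hN0,
    integral_Ioi_cpow_of_lt (by simp; linarith) hN0, mellin_neg_eq_setIntegral hN0 (tailError_of_le χ c N)]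
  have hNc : (N : ℂ) ≠ 0 := by exact_mod_cast hN0.ne'
  rw [show -(s + 1) + 1 = -s by ring, show -s + 1 = 1 - s by ring]
  have : (((N : ℝ) : ℂ)) ^ (-s) = (N : ℂ) ^ (1 - s) / N := by
    rw [ofReal_natCast, eq_div_iff hNc]
    nth_rw 2 [← cpow_one (N : ℂ)]
    rw [← cpow_add _ _ hNc]; congr 1; ring
  rw [this, ofReal_natCast]
  have hs2 : 1 - s ≠ 0 := fun h ↦ hs1 (by linear_combination -h)
  field_simp
  ring

lemma LFunction_eq_of_one_lt_re {q : ℕ} [NeZero q] (χ : DirichletCharacter ℂ q) {c : ℂ} {B : ℝ} (hB : 0 ≤ B)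
    (h : ∀ n : ℕ, ‖∑ k ∈ Icc 1 n, χ k - c * n‖ ≤ B) {N : ℕ} (hN : 1 ≤ N) {s : ℂ} (hs : 1 < s.re) :
    LFunction χ s = ∑ n ∈ Icc 1 N, χ n * (n : ℂ) ^ (-s) + (c * (N : ℂ) ^ (1 - s) / (s - 1)
      + s * mellin (tailError χ c N) (-s)) := by
  rw [LFunction_eq_LSeries χ hs, ← LSeries_truncated_eq χ hB h hN hs]
  have hsum := LSeriesSummable_of_one_lt_re χ hs
  have h1 : HasSum (LSeries.term (fun n ↦ if n ≤ N then χ n else 0) s)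
      (∑ n ∈ Icc 1 N, χ n * (n : ℂ) ^ (-s)) := by
    have : ∑ n ∈ Icc 1 N, χ n * (n : ℂ) ^ (-s) =
        ∑ n ∈ Icc 1 N, LSeries.term (fun n ↦ if n ≤ N then χ n else 0) s n := by
      refine Finset.sum_congr rfl fun n hn ↦ ?_
      have hn' := Finset.mem_Icc.mp hn
      rw [LSeries.term_of_ne_zero (by omega), if_pos hn'.2, cpow_neg, div_eq_mul_inv]
    rw [this]
    refine hasSum_sum_of_ne_finset_zero fun n hn ↦ ?_
    rcases eq_or_ne n 0 with rfl | h0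
    · simp
    · rw [LSeries.term_of_ne_zero h0, if_neg, zero_div]
      intro hle
      exact hn (Finset.mem_Icc.mpr ⟨by omega, hle⟩)
  have h2 : LSeriesSummable (fun n ↦ if n ≤ N then 0 else χ n) s := by
    have : (fun n : ℕ ↦ if n ≤ N then 0 else χ n) =
      (fun n : ℕ ↦ χ n) - (fun n : ℕ ↦ if n ≤ N then χ n else 0) := by
        ext n; simp only [Pi.sub_apply]; split_ifs <;> simp
    rw [this]
    exact hsum.sub h1.summable
  have h3 := LSeries_add (f := fun n : ℕ ↦ if n ≤ N then χ n else 0) h1.summable h2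
  rw [show LSeries (fun n : ℕ ↦ if n ≤ N then χ n else 0) s = _ from h1.tsum_eq] at h3
  rw [← h3]
  congr 1
  ext n
  simp only [Pi.add_apply]; split_ifs <;> simp

/-- The truncated formula for a Dirichlet `L`-function, valid in the half-plane `0 < re s`. -/
lemma LFunction_eq_truncated {q : ℕ} [NeZero q] (χ : DirichletCharacter ℂ q) {c : ℂ} {B : ℝ} (hB : 0 ≤ B)
    (h : ∀ n : ℕ, ‖∑ k ∈ Icc 1 n, χ k - c * n‖ ≤ B) {N : ℕ} (hN : 1 ≤ N) {s : ℂ} (hs : 0 < s.re)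
    (him : s.im ≠ 0) :
    LFunction χ s = ∑ n ∈ Icc 1 N, χ n * (n : ℂ) ^ (-s) + (c * (N : ℂ) ^ (1 - s) / (s - 1)
      + s * mellin (tailError χ c N) (-s)) := by
  let U : Set ℂ := {z | 0 < z.re} ∩ {z | 0 < s.im * z.im}
  have hUo : IsOpen U := (isOpen_lt continuous_const continuous_re).inter
    (isOpen_lt continuous_const (continuous_const.mul continuous_im))
  have hUc : Convex ℝ U := by
    refine (convex_halfSpace_re_gt 0).inter ?_
    exact convex_halfSpace_gt (f := fun z : ℂ ↦ s.im * z.im)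
      ⟨fun x y ↦ by simp; ring, fun c x ↦ by simp; ring⟩ 0
  have hne : ∀ z ∈ U, z ≠ 1 := by
    rintro z hz rfl
    simpa using hz.2
  have hN0 : (N : ℂ) ≠ 0 := by exact_mod_cast (by omega : N ≠ 0)
  have hf : DifferentiableOn ℂ (LFunction χ) U := fun z hz ↦
    (differentiableAt_LFunction χ z (.inl (hne z hz))).differentiableWithinAt
  have hg : DifferentiableOn ℂ (fun s ↦ ∑ n ∈ Icc 1 N, χ n * (n : ℂ) ^ (-s) + (c * (N : ℂ) ^ (1 - s) / (s - 1)
      + s * mellin (tailError χ c N) (-s))) U := by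
    intro z hz
    refine DifferentiableAt.differentiableWithinAt ?_
    refine .add ?_ (.add ?_ ?_)
    · refine DifferentiableAt.fun_sum fun n hn ↦ ?_
      have : (n : ℂ) ≠ 0 := by
        have := (Finset.mem_Icc.mp hn).1
        exact_mod_cast (by omega : n ≠ 0)
      exact (differentiableAt_id.neg.const_cpow (.inl this)).const_mul _
    · refine .div ?_ (by fun_prop) (sub_ne_zero.mpr (hne z hz))
      exact ((differentiableAt_id.const_sub 1).const_cpow (.inl hN0)).const_mul _
    · exact differentiableAt_id.mul (differentiableAt_mellin_neg (measurable_tailError χ c N)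
        (by exact_mod_cast hN : (0 : ℝ) < N) (norm_tailError_le hB h N) (tailError_of_le χ c N) hz.1)
  have hz0 : (2 + s.im * I : ℂ) ∈ U := by
    constructor
    · simp
    · simpa using mul_self_pos.mpr him
  refine (hf.analyticOnNhd hUo).eqOn_of_preconnected_of_eventuallyEq (hg.analyticOnNhd hUo)
    hUc.isPreconnected hz0 ?_ (show s ∈ U from ⟨hs, mul_self_pos.mpr him⟩)
  have : {z : ℂ | 1 < z.re} ∈ 𝓝 (2 + s.im * I : ℂ) :=
    (isOpen_lt continuous_const continuous_re).mem_nhds (by simp)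
  filter_upwards [this] with z hz
  exact LFunction_eq_of_one_lt_re χ hB h hN hz

end TruncatedSeries

section LFunctionBounds

/-- A small power of the height dominates `L(s, χ)` slightly to the left of the line `re s = 1`. -/
lemma exists_norm_LFunction_le {q : ℕ} [NeZero q] (χ : DirichletCharacter ℂ q) :
    ∃ A : ℝ, 1 ≤ A ∧ ∀ s : ℂ, 31 / 32 ≤ s.re → s.re ≤ 3 → 1 ≤ |s.im| →
      ‖LFunction χ s‖ ≤ A * |s.im| ^ (1 / 16 : ℝ) := by
  obtain ⟨c, B, hB, h⟩ := exists_norm_sum_sub_le χ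
  set Z : ℝ := ∑' n : ℕ, (n : ℝ) ^ (-(33 / 32) : ℝ)
  have hZs : Summable fun n : ℕ ↦ (n : ℝ) ^ (-(33 / 32) : ℝ) :=
    Real.summable_nat_rpow.mpr (by norm_num)
  have hZ0 : 0 ≤ Z := tsum_nonneg fun n ↦ by positivity
  set M := 2 * B + ‖c‖ with hMdef
  have hM0 : 0 ≤ M := by positivity
  refine ⟨2 * (Z + ‖c‖ + 8 * M) + 1, ?_, fun s hs hs3 ht ↦ ?_⟩
  · have := norm_nonneg c
    linarith
  set N := ⌈|s.im|⌉₊ with hN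
  have hN1 : 1 ≤ N := Nat.one_le_ceil_iff.mpr (by linarith)
  have hN1' : (1 : ℝ) ≤ N := by exact_mod_cast hN1
  have hN0' : (0 : ℝ) < N := by linarith
  have hNt : |s.im| ≤ N := Nat.le_ceil _
  have hNt2 : (N : ℝ) ≤ 2 * |s.im| := by
    have := Nat.ceil_lt_add_one (abs_nonneg s.im)
    linarith
  set X := (N : ℝ) ^ (1 / 16 : ℝ) with hX
  have hX0 : 0 < X := by positivity
  have t1 : ‖∑ n ∈ Icc 1 N, χ n * (n : ℂ) ^ (-s)‖ ≤ X * Z := by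
    refine (norm_sum_le _ _).trans ?_
    calc _ ≤ ∑ n ∈ Icc 1 N, X * (n : ℝ) ^ (-(33 / 32) : ℝ) := by
          refine Finset.sum_le_sum fun n hn ↦ ?_
          obtain ⟨hn1, hn2⟩ := Finset.mem_Icc.mp hn
          have hn0 : (0 : ℝ) < n := by exact_mod_cast hn1
          have hn1' : (1 : ℝ) ≤ n := by exact_mod_cast hn1
          rw [norm_mul, norm_natCast_cpow_of_pos (by omega)]
          calc _ ≤ 1 * (n : ℝ) ^ (-s).re := by gcongr; exact χ.norm_le_one _
            _ ≤ (n : ℝ) ^ (1 / 16 + -(33 / 32) : ℝ) := by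
              rw [one_mul]
              exact Real.rpow_le_rpow_of_exponent_le hn1' (by simp; linarith)
            _ = (n : ℝ) ^ (1 / 16 : ℝ) * (n : ℝ) ^ (-(33 / 32) : ℝ) := Real.rpow_add hn0 _ _
            _ ≤ _ := by
              refine mul_le_mul_of_nonneg_right ?_ (by positivity)
              exact Real.rpow_le_rpow hn0.le (by exact_mod_cast hn2) (by norm_num)
      _ = X * ∑ n ∈ Icc 1 N, (n : ℝ) ^ (-(33 / 32) : ℝ) := by rw [Finset.mul_sum]
      _ ≤ _ := by
        gcongr
        exact hZs.sum_le_tsum _ fun n _ ↦ by positivity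
  have t2 : ‖c * (N : ℂ) ^ (1 - s) / (s - 1)‖ ≤ X * ‖c‖ := by
    rw [norm_div, norm_mul, norm_natCast_cpow_of_pos (by omega)]
    have h1 : 1 ≤ ‖s - 1‖ := by
      refine ht.trans ?_
      simpa using abs_im_le_norm (s - 1)
    have h2 : (N : ℝ) ^ (1 - s).re ≤ X :=
      Real.rpow_le_rpow_of_exponent_le hN1' (by simp; linarith)
    refine (div_le_self (by positivity) h1).trans ?_
    rw [mul_comm]
    gcongr
  have t3 : ‖s * mellin (tailError χ c N) (-s)‖ ≤ X * (8 * M) := by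
    rw [norm_mul]
    have hs0 : 0 < s.re := by linarith
    have h1 := norm_mellin_neg_le hN0' (norm_tailError_le hB h N) (tailError_of_le χ c N) hs0
    have h2 : ‖s‖ ≤ 4 * N := by
      refine (norm_le_abs_re_add_abs_im s).trans ?_
      rw [abs_of_pos hs0]; linarith
    have h3 : (N : ℝ) ^ (-s.re) / s.re ≤ 2 * (X * (N : ℝ)⁻¹) := by
      have : (N : ℝ) ^ (-s.re) ≤ X * (N : ℝ)⁻¹ := by
        rw [hX, ← Real.rpow_neg_one, ← Real.rpow_add hN0']
        exact Real.rpow_le_rpow_of_exponent_le hN1' (by linarith)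
      rw [div_le_iff₀ hs0]
      refine this.trans ?_
      have : 0 ≤ X * (N : ℝ)⁻¹ := by positivity
      nlinarith
    calc _ ≤ 4 * N * (M * (2 * (X * (N : ℝ)⁻¹))) := by
          refine mul_le_mul h2 (h1.trans ?_) (norm_nonneg _) (by positivity)
          gcongr
      _ = X * (8 * M) := by field_simp; ring
  rw [LFunction_eq_truncated χ hB h hN1 (by linarith) (fun h0 ↦ by simp [h0] at ht; linarith)]
  have hXt : X ≤ 2 * |s.im| ^ (1 / 16 : ℝ) := by
    calc X ≤ (2 * |s.im|) ^ (1 / 16 : ℝ) := Real.rpow_le_rpow hN0'.le hNt2 (by norm_num)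
      _ = 2 ^ (1 / 16 : ℝ) * |s.im| ^ (1 / 16 : ℝ) := Real.mul_rpow (by norm_num) (abs_nonneg _)
      _ ≤ _ := by
        gcongr
        calc (2 : ℝ) ^ (1 / 16 : ℝ) ≤ 2 ^ (1 : ℝ) :=
              Real.rpow_le_rpow_of_exponent_le (by norm_num) (by norm_num)
          _ = 2 := Real.rpow_one 2
  calc _ ≤ X * Z + (X * ‖c‖ + X * (8 * M)) :=
        (norm_add_le _ _).trans (add_le_add t1 ((norm_add_le _ _).trans (add_le_add t2 t3)))
    _ = X * (Z + ‖c‖ + 8 * M) := by ring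
    _ ≤ (2 * |s.im| ^ (1 / 16 : ℝ)) * (Z + ‖c‖ + 8 * M) := by gcongr
    _ ≤ _ := by
      have : 0 ≤ |s.im| ^ (1 / 16 : ℝ) := by positivity
      linarith

lemma two_mul_rpow_le {a b : ℝ} (ha : 0 ≤ a) (h : a ≤ 2 * b) :
    a ^ (1 / 16 : ℝ) ≤ 2 * b ^ (1 / 16 : ℝ) := by
  have hb : 0 ≤ b := by linarith
  calc a ^ (1 / 16 : ℝ) ≤ (2 * b) ^ (1 / 16 : ℝ) := Real.rpow_le_rpow ha h (by norm_num)
    _ = 2 ^ (1 / 16 : ℝ) * b ^ (1 / 16 : ℝ) := Real.mul_rpow (by norm_num) hb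
    _ ≤ _ := by
      gcongr
      calc (2 : ℝ) ^ (1 / 16 : ℝ) ≤ 2 ^ (1 : ℝ) :=
            Real.rpow_le_rpow_of_exponent_le (by norm_num) (by norm_num)
        _ = 2 := Real.rpow_one 2

lemma exists_norm_deriv_LFunction_le {q : ℕ} [NeZero q] (χ : DirichletCharacter ℂ q) :
    ∃ A : ℝ, 1 ≤ A ∧ ∀ s : ℂ, 63 / 64 ≤ s.re → s.re ≤ 5 / 2 → 3 / 2 ≤ |s.im| →
      ‖deriv (LFunction χ) s‖ ≤ A * |s.im| ^ (1 / 16 : ℝ) := by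
  obtain ⟨A, hA, h⟩ := exists_norm_LFunction_le χ
  refine ⟨128 * A, by linarith, fun s h1 h2 h3 ↦ ?_⟩
  have key : ∀ z, ‖z - s‖ ≤ 1 / 64 → |z.re - s.re| ≤ 1 / 64 ∧ |z.im - s.im| ≤ 1 / 64 :=
    fun z hz ↦ ⟨by simpa using (abs_re_le_norm (z - s)).trans hz,
      by simpa using (abs_im_le_norm (z - s)).trans hz⟩
  have habs : ∀ z, ‖z - s‖ ≤ 1 / 64 → 1 ≤ |z.im| ∧ |z.im| ≤ 2 * |s.im| := fun z hz ↦ by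
    have h4 := (key z hz).2
    have h5 := abs_sub_abs_le_abs_sub s.im z.im
    have h6 := abs_sub_abs_le_abs_sub z.im s.im
    rw [abs_sub_comm] at h5
    constructor <;> linarith
  have hd : DiffContOnCl ℂ (LFunction χ) (Metric.ball s (1 / 64)) := by
    refine DifferentiableOn.diffContOnCl fun z hz ↦ ?_
    have hz' : ‖z - s‖ ≤ 1 / 64 := by
      have := Metric.closure_ball_subset_closedBall hz
      simpa [dist_eq_norm] using this
    refine (differentiableAt_LFunction χ z (.inl ?_)).differentiableWithinAt
    rintro rfl
    have := (habs 1 hz').1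
    simp at this
    linarith
  have := Complex.norm_deriv_le_of_forall_mem_sphere_norm_le (C := A * (2 * |s.im| ^ (1 / 16 : ℝ)))
    (by norm_num) hd fun z hz ↦ ?_
  · refine this.trans (le_of_eq ?_)
    ring
  · have hz' : ‖z - s‖ ≤ 1 / 64 := by
      rw [mem_sphere_iff_norm] at hz; exact hz.le
    obtain ⟨h4, h5⟩ := habs z hz'
    have h6 := abs_le.mp (key z hz').1
    refine (h z (by linarith) (by linarith) h4).trans ?_
    gcongr
    exact two_mul_rpow_le (abs_nonneg _) h5

lemma exists_norm_LFunctionTrivChar_le {q : ℕ} [NeZero q] :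
    ∃ B : ℝ, 1 ≤ B ∧ ∀ x : ℝ, 0 < x → x ≤ 1 → ‖LFunctionTrivChar q (1 + x)‖ ≤ B / x := by
  have hc : Continuous fun x : ℝ ↦ LFunctionTrivChar₁ q (1 + x) :=
    (differentiable_LFunctionTrivChar₁ q).continuous.comp (by fun_prop)
  obtain ⟨B, hB⟩ := isCompact_Icc.exists_bound_of_continuousOn (s := Set.Icc (0 : ℝ) 1) hc.continuousOn
  refine ⟨max B 1, le_max_right _ _, fun x hx hx1 ↦ ?_⟩
  have h := hB x ⟨hx.le, hx1⟩
  have hx' : (1 + x : ℂ) ≠ 1 := by simpa using hx.ne'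
  rw [LFunctionTrivChar₁, Function.update_of_ne hx', norm_mul] at h
  rw [le_div_iff₀ hx, mul_comm]
  refine le_trans ?_ (h.trans (le_max_left _ _))
  simp [abs_of_pos hx]

lemma exists_le_norm_LFunction {q : ℕ} [NeZero q] (χ : DirichletCharacter ℂ q) :
    ∃ c : ℝ, 0 < c ∧ ∀ s : ℂ, 1 ≤ s.re → s.re ≤ 2 → 2 ≤ |s.im| →
      c / (|s.im| ^ (1 / 16 : ℝ)) ^ 4 ≤ ‖LFunction χ s‖ := by
  obtain ⟨A, hA, hA'⟩ := exists_norm_LFunction_le (χ ^ 2)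
  obtain ⟨A₁, hA₁, hA₁'⟩ := exists_norm_deriv_LFunction_le χ
  obtain ⟨B, hB, hB'⟩ := exists_norm_LFunctionTrivChar_le (q := q)
  set D := 2 * A * B ^ 3 with hD
  have hD1 : 1 ≤ D := by
    have : 1 ≤ B ^ 3 := one_le_pow₀ hB
    nlinarith
  set l := 1 / (2 * D * A₁) with hl
  have hDA : 0 < 2 * D * A₁ := by positivity
  have hl0 : 0 < l := by positivity
  have hl1 : l ≤ 1 := by
    rw [hl, div_le_one hDA]; nlinarith
  have hlA : l * A₁ = 1 / (2 * D) := by rw [hl]; field_simp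
  -- bound away from the line
  have far : ∀ x t : ℝ, 0 < x → x ≤ 1 → 2 ≤ |t| →
      l ^ 4 / (|t| ^ (1 / 16 : ℝ)) ^ 5 ≤ x →
      l ^ 3 / D / (|t| ^ (1 / 16 : ℝ)) ^ 4 ≤ ‖LFunction χ (1 + x + I * t)‖ := by
    intro x t hx hx1 ht hxl
    set y := |t| ^ (1 / 16 : ℝ) with hy
    have hy0 : 0 < y := by positivity
    have h1 := norm_LFunction_product_ge_one χ hx t
    rw [norm_mul, norm_mul, norm_pow, norm_pow] at h1
    have h2 := hA' (1 + x + 2 * I * t) (by simp; linarith) (by simp; linarith)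
      (by simp [abs_mul]; linarith)
    have h3 : |(1 + x + 2 * I * t : ℂ).im| ^ (1 / 16 : ℝ) ≤ 2 * y :=
      two_mul_rpow_le (abs_nonneg _) (by simp [abs_mul])
    have h4 : ‖LFunction (χ ^ 2) (1 + x + 2 * I * t)‖ ≤ A * (2 * y) := h2.trans (by gcongr)
    set P := ‖LFunction χ (1 + x + I * t)‖ with hP
    have hP0 : 0 ≤ P := norm_nonneg _
    have h5 : 1 ≤ (B / x) ^ 3 * P ^ 4 * (A * (2 * y)) := by
      refine le_trans h1 ?_
      gcongr
      exact hB' x hx hx1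
    have h6 : x ^ 3 ≤ D * y * P ^ 4 := by
      have : (B / x) ^ 3 * P ^ 4 * (A * (2 * y)) = D * y * P ^ 4 / x ^ 3 := by
        rw [hD]; field_simp
      rw [this, one_le_div (by positivity)] at h5
      exact h5
    have h7 : (l ^ 4 / y ^ 5) ^ 3 ≤ D * y * P ^ 4 := by
      refine le_trans ?_ h6
      gcongr
    have h8 : (l ^ 3 / y ^ 4) ^ 4 ≤ D * P ^ 4 := by
      have e1 : (l ^ 3 / y ^ 4) ^ 4 = (l ^ 4 / y ^ 5) ^ 3 / y := by field_simp
      rw [e1, div_le_iff₀ hy0]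
      linarith
    have h9 : (l ^ 3 / D / y ^ 4) ^ 4 ≤ P ^ 4 := by
      have e1 : (l ^ 3 / D / y ^ 4) ^ 4 = (l ^ 3 / y ^ 4) ^ 4 / D ^ 4 := by field_simp
      rw [e1, div_le_iff₀ (by positivity)]
      refine h8.trans ?_
      rw [mul_comm]
      gcongr
      exact le_self_pow₀ hD1 (by norm_num)
    exact le_of_pow_le_pow_left₀ (by norm_num) hP0 h9
  refine ⟨l ^ 3 / (2 * D), by positivity, fun s h1 h2 h3 ↦ ?_⟩
  set y := |s.im| ^ (1 / 16 : ℝ) with hy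
  have hy1 : 1 ≤ y := Real.one_le_rpow (by linarith) (by norm_num)
  have hy0 : 0 < y := by linarith
  have hx₀ : l ^ 4 / y ^ 5 ≤ 1 := by
    rw [div_le_one (by positivity)]
    exact (pow_le_one₀ hl0.le hl1).trans (one_le_pow₀ hy1)
  have es : ∀ x : ℝ, (1 + x + I * s.im : ℂ).re = 1 + x ∧ (1 + x + I * s.im : ℂ).im = s.im :=
    fun x ↦ by simp
  have hhalf : l ^ 3 / (2 * D) / y ^ 4 = l ^ 3 / D / y ^ 4 / 2 := by field_simp
  by_cases hcase : l ^ 4 / y ^ 5 ≤ s.re - 1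
  · have h4 := far (s.re - 1) s.im (lt_of_lt_of_le (by positivity) hcase) (by linarith) h3 hcase
    have e : (1 + (s.re - 1 : ℝ) + I * s.im : ℂ) = s := by
      apply Complex.ext <;> simp
    rw [e] at h4
    refine le_trans ?_ h4
    rw [hhalf]
    have : 0 ≤ l ^ 3 / D / y ^ 4 := by positivity
    linarith
  · push Not at hcase
    set x₀ := l ^ 4 / y ^ 5 with hx₀'
    have hx₀0 : 0 < x₀ := by positivity
    have h4 := far x₀ s.im hx₀0 hx₀ h3 le_rfl
    rw [← hy] at h4
    set w : ℂ := 1 + x₀ + I * s.im with hw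
    have hS : Convex ℝ ({z : ℂ | z.re ∈ Set.Icc 1 2} ∩ {z : ℂ | z.im ∈ Set.Icc s.im s.im}) :=
      ((convex_Icc (1 : ℝ) 2).linear_preimage reLm).inter
        ((convex_Icc (s.im : ℝ) s.im).linear_preimage imLm)
    have h5 : ‖LFunction χ w - LFunction χ s‖ ≤ A₁ * y * ‖w - s‖ := by
      refine hS.norm_image_sub_le_of_norm_deriv_le (f := LFunction χ) (fun z hz ↦ ?_) (fun z hz ↦ ?_)
        ⟨⟨h1, h2⟩, by simp⟩ ⟨?_, ?_⟩
      · refine differentiableAt_LFunction χ z (.inl ?_)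
        rintro rfl
        have : s.im = 0 := by simpa using le_antisymm hz.2.1 hz.2.2
        rw [this] at h3; simp at h3; linarith
      · have him : z.im = s.im := le_antisymm hz.2.2 hz.2.1
        have := hA₁' z (by linarith [hz.1.1]) (by linarith [hz.1.2]) (by rw [him]; linarith)
        rwa [him] at this
      · change w.re ∈ Set.Icc (1 : ℝ) 2; rw [(es x₀).1]; constructor <;> linarith
      · change w.im ∈ Set.Icc s.im s.im; rw [(es x₀).2]; simp
    have h6 : ‖w - s‖ ≤ x₀ := by
      have : w - s = ((x₀ - (s.re - 1) : ℝ) : ℂ) := by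
        apply Complex.ext
        · simp [hw]; ring
        · simp [hw]
      rw [this, norm_real, Real.norm_eq_abs, abs_le]
      constructor <;> linarith
    have h7 : A₁ * y * ‖w - s‖ ≤ l ^ 3 / D / y ^ 4 / 2 := by
      calc _ ≤ A₁ * y * x₀ := by gcongr
        _ = (l * A₁) * (l ^ 3 / y ^ 4) := by rw [hx₀']; field_simp
        _ = _ := by rw [hlA]; field_simp
    have h8 := norm_sub_norm_le (LFunction χ w) (LFunction χ s)
    rw [hhalf]
    linarith

end LFunctionBounds

section RegularPart

open Classical in
/-- The order of the pole of `L(s, χ)` at `s = 1`. -/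
noncomputable def poleOrder {q : ℕ} (χ : DirichletCharacter ℂ q) : ℝ := if χ = 1 then 1 else 0

open Classical in
/-- `L(s, χ)` with a possible pole at `s = 1` removed. -/
noncomputable def entireL {q : ℕ} [NeZero q] (χ : DirichletCharacter ℂ q) : ℂ → ℂ :=
  if χ = 1 then LFunctionTrivChar₁ q else LFunction χ

/-- The regular part of minus the logarithmic derivative of `L(1 + z, χ)` near `z = 0`. -/
noncomputable def regPart {q : ℕ} [NeZero q] (χ : DirichletCharacter ℂ q) (z : ℂ) : ℂ :=
  -(deriv (entireL χ) (1 + z) / entireL χ (1 + z))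

/-- The difference quotient at `0` of `regPart χ`. -/
noncomputable def regQuot {q : ℕ} [NeZero q] (χ : DirichletCharacter ℂ q) : ℂ → ℂ :=
  dslope (regPart χ) 0

variable {q : ℕ} [NeZero q] (χ : DirichletCharacter ℂ q)

lemma differentiable_entireL : Differentiable ℂ (entireL χ) := by
  unfold entireL
  split_ifs with h
  · exact differentiable_LFunctionTrivChar₁ q
  · exact differentiable_LFunction h

lemma entireL_ne_zero {s : ℂ} (hs : 1 ≤ s.re) : entireL χ s ≠ 0 := by
  unfold entireL
  split_ifs with h
  · rcases eq_or_ne s 1 with rfl | h1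
    · exact LFunctionTrivChar₁_apply_one_ne_zero q
    · rw [LFunctionTrivChar₁, Function.update_of_ne h1]
      exact mul_ne_zero (sub_ne_zero.mpr h1)
        (LFunction_ne_zero_of_one_le_re (1 : DirichletCharacter ℂ q) (.inr h1) hs)
  · exact LFunction_ne_zero_of_one_le_re χ (.inl h) hs

lemma isOpen_setOf_entireL_ne_zero : IsOpen {z : ℂ | entireL χ (1 + z) ≠ 0} :=
  isOpen_ne_fun ((differentiable_entireL χ).continuous.comp (by fun_prop)) continuous_const

lemma differentiableOn_regQuot :
    DifferentiableOn ℂ (regQuot χ) {z : ℂ | entireL χ (1 + z) ≠ 0} := by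
  have h0 : (0 : ℂ) ∈ {z : ℂ | entireL χ (1 + z) ≠ 0} := by
    simpa using entireL_ne_zero χ (s := 1) (by simp)
  refine (Complex.differentiableOn_dslope
    ((isOpen_setOf_entireL_ne_zero χ).mem_nhds h0)).mpr ?_
  have h1 : Differentiable ℂ fun z ↦ entireL χ (1 + z) :=
    (differentiable_entireL χ).comp (by fun_prop)
  have h2 : Differentiable ℂ fun z ↦ deriv (entireL χ) (1 + z) :=
    ((differentiable_entireL χ).deriv).comp (by fun_prop)
  exact (h2.differentiableOn.div h1.differentiableOn fun z hz ↦ hz).neg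

lemma setOf_zero_le_re_subset : {z : ℂ | 0 ≤ z.re} ⊆ {z : ℂ | entireL χ (1 + z) ≠ 0} :=
  fun z hz ↦ entireL_ne_zero χ (by simpa using hz)

lemma regPart_eq {z : ℂ} (hz : z ≠ 0) (hL : LFunction χ (1 + z) ≠ 0) :
    regPart χ z = -(deriv (LFunction χ) (1 + z) / LFunction χ (1 + z)) - poleOrder χ / z := by
  unfold regPart poleOrder entireL
  split_ifs with h
  · subst h
    have h1 : (1 + z) ≠ 1 := by simpa using hz
    rw [deriv_LFunctionTrivChar₁_apply_of_ne_one q h1, LFunctionTrivChar₁,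
      Function.update_of_ne h1]
    have : LFunctionTrivChar q (1 + z) ≠ 0 := hL
    change _ = -(deriv (LFunctionTrivChar q) (1 + z) / LFunctionTrivChar q (1 + z)) - _
    push_cast
    field_simp
    ring
  · simp

lemma regQuot_eq {z : ℂ} (hz : z ≠ 0) (hL : LFunction χ (1 + z) ≠ 0) :
    regQuot χ z = (-(deriv (LFunction χ) (1 + z) / LFunction χ (1 + z)) - poleOrder χ / z
      - regPart χ 0) / z := by
  rw [regQuot, dslope_of_ne _ hz, slope_def_field, regPart_eq χ hz hL, sub_zero]

lemma abs_poleOrder_le : |poleOrder χ| ≤ 1 := by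
  unfold poleOrder; split_ifs <;> simp

lemma exists_norm_iteratedDeriv_regQuot_le_of_le_im :
    ∃ B : ℝ, 0 ≤ B ∧ ∀ z : ℂ, 0 ≤ z.re → z.re ≤ 1 → 3 ≤ |z.im| →
      ‖iteratedDeriv 2 (regQuot χ) z‖ ≤ B := by
  obtain ⟨c₀, hc₀, hc₀'⟩ := exists_le_norm_LFunction χ
  obtain ⟨A, hA, hA'⟩ := exists_norm_deriv_LFunction_le χ
  set c := min c₀ (1 / 16) with hc
  have hc0 : 0 < c := lt_min hc₀ (by norm_num)
  set K := 2 * (4 * A / c + 1 + ‖regPart χ 0‖) with hK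
  have hK0 : 0 ≤ K := by positivity
  refine ⟨32 * K * A ^ 2 / c ^ 2, by positivity, fun z h1 h2 h3 ↦ ?_⟩
  set y := |z.im| ^ (1 / 16 : ℝ) with hy
  have hy1 : 1 ≤ y := Real.one_le_rpow (by linarith) (by norm_num)
  have hy16 : y ^ 16 = |z.im| := by
    rw [hy, ← Real.rpow_natCast, ← Real.rpow_mul (abs_nonneg _)]; norm_num
  set ρ := c / (4 * A * y ^ 5) with hρ
  have hy5 : 1 ≤ y ^ 5 := one_le_pow₀ hy1
  have hρ0 : 0 < ρ := by positivity
  have hρ1 : ρ ≤ 1 / 64 := by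
    rw [hρ, div_le_iff₀ (by positivity)]
    have : c ≤ 1 / 16 := min_le_right _ _
    nlinarith [mul_le_mul hA hy5 zero_le_one (by linarith)]
  have key : ∀ w ∈ Metric.closedBall z ρ, |w.re - z.re| ≤ 1 / 64 ∧ |w.im - z.im| ≤ 1 / 64 :=
    fun w hw ↦ by
      have hw : ‖w - z‖ ≤ 1 / 64 := (mem_closedBall_iff_norm.mp hw).trans hρ1
      exact ⟨by simpa using (abs_re_le_norm (w - z)).trans hw,
        by simpa using (abs_im_le_norm (w - z)).trans hw⟩
  have him : ∀ w ∈ Metric.closedBall z ρ, 2 ≤ |w.im| ∧ |w.im| ≤ 2 * |z.im| ∧ |z.im| ≤ 2 * |w.im| :=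
    fun w hw ↦ by
      have := (key w hw).2
      have h5 := abs_sub_abs_le_abs_sub z.im w.im
      have h6 := abs_sub_abs_le_abs_sub w.im z.im
      rw [abs_sub_comm] at h5
      refine ⟨?_, ?_, ?_⟩ <;> linarith
  have hder : ∀ w ∈ Metric.closedBall z ρ, ‖deriv (LFunction χ) (1 + w)‖ ≤ 2 * A * y := fun w hw ↦ by
    have h5 := him w hw
    have h6 := abs_le.mp (key w hw).1
    have := hA' (1 + w) (by simp; linarith) (by simp; linarith) (by simp; linarith)
    refine this.trans ?_
    have h7 := two_mul_rpow_le (abs_nonneg w.im) h5.2.1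
    simp only [add_im, one_im, zero_add]
    nlinarith
  have hne1 : ∀ w ∈ Metric.closedBall z ρ, w ≠ 0 := fun w hw h ↦ by
    have := (him w hw).1
    rw [h] at this; norm_num at this
  have hlow : ∀ w ∈ Metric.closedBall z ρ, c / (2 * y ^ 4) ≤ ‖LFunction χ (1 + w)‖ := fun w hw ↦ by
    have h5 : ‖LFunction χ (1 + w) - LFunction χ (1 + z)‖ ≤ 2 * A * y * ‖w - z‖ := by
      refine (convex_closedBall z ρ).norm_image_sub_le_of_norm_deriv_le
        (f := fun w ↦ LFunction χ (1 + w)) (fun v hv ↦ ?_) (fun v hv ↦ ?_)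
        (Metric.mem_closedBall_self hρ0.le) hw
      · exact (differentiableAt_LFunction χ _ (.inl (by simpa using hne1 v hv))).comp _
          (by fun_prop)
      · rw [deriv_comp_const_add]; exact hder v hv
    have h6 := hc₀' (1 + z) (by simp; linarith) (by simp; linarith) (by simp; linarith)
    simp only [add_im, one_im, zero_add] at h6
    have h7 : ‖w - z‖ ≤ ρ := mem_closedBall_iff_norm.mp hw
    have h8 : 2 * A * y * ‖w - z‖ ≤ c / (2 * y ^ 4) := by
      calc 2 * A * y * ‖w - z‖ ≤ 2 * A * y * ρ := by gcongr
        _ = c / (2 * y ^ 4) := by rw [hρ]; field_simp; norm_num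
    have h9 : c / y ^ 4 ≤ c₀ / y ^ 4 := by gcongr; exact min_le_left _ _
    have h10 : c / y ^ 4 = 2 * (c / (2 * y ^ 4)) := by field_simp
    have h11 := norm_sub_norm_le (LFunction χ (1 + z)) (LFunction χ (1 + w))
    rw [norm_sub_rev] at h11
    linarith
  have hne2 : ∀ w ∈ Metric.closedBall z ρ, LFunction χ (1 + w) ≠ 0 := fun w hw h ↦ by
    have := hlow w hw
    rw [h, norm_zero] at this
    have : 0 < c / (2 * y ^ 4) := by positivity
    linarith
  have hbd : ∀ w ∈ Metric.closedBall z ρ, ‖regQuot χ w‖ ≤ K * y ^ 5 / y ^ 16 := fun w hw ↦ by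
    rw [regQuot_eq χ (hne1 w hw) (hne2 w hw), norm_div]
    have h5 := him w hw
    have h6 : y ^ 16 / 2 ≤ ‖w‖ := by
      rw [hy16]; linarith [abs_im_le_norm w]
    have h7 : ‖(poleOrder χ : ℂ) / w‖ ≤ 1 := by
      rw [norm_div, norm_real, Real.norm_eq_abs]
      refine div_le_one_of_le₀ ?_ (norm_nonneg _)
      linarith [abs_im_le_norm w, abs_poleOrder_le χ]
    have h8 : ‖deriv (LFunction χ) (1 + w) / LFunction χ (1 + w)‖ ≤ 4 * A / c * y ^ 5 := by
      rw [norm_div]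
      calc _ ≤ 2 * A * y / (c / (2 * y ^ 4)) := by
            gcongr
            · exact hder w hw
            · exact hlow w hw
        _ = _ := by field_simp; ring
    calc _ ≤ (4 * A / c * y ^ 5 + 1 + ‖regPart χ 0‖) / (y ^ 16 / 2) := by
          gcongr
          refine (norm_sub_le _ _).trans ?_
          gcongr
          refine (norm_sub_le _ _).trans ?_
          rw [norm_neg]
          gcongr
      _ ≤ (4 * A / c * y ^ 5 + 1 * y ^ 5 + ‖regPart χ 0‖ * y ^ 5) / (y ^ 16 / 2) := by
          gcongr
          · linarith
          · exact le_mul_of_one_le_right (norm_nonneg _) hy5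
      _ = _ := by rw [hK]; field_simp
  have hU : ∀ w ∈ Metric.closedBall z ρ, DifferentiableAt ℂ (regQuot χ) w := fun w hw ↦ by
    refine (differentiableOn_regQuot χ).differentiableAt
      ((isOpen_setOf_entireL_ne_zero χ).mem_nhds ?_)
    change entireL χ (1 + w) ≠ 0
    have h4 : (1 + w) ≠ 1 := by simpa using hne1 w hw
    unfold entireL
    split_ifs with h
    · rw [LFunctionTrivChar₁, Function.update_of_ne h4]
      have := hne2 w hw
      rw [h] at this
      exact mul_ne_zero (sub_ne_zero.mpr h4) this
    · exact hne2 w hw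
  have hcau := Complex.norm_iteratedDeriv_le_of_forall_mem_sphere_norm_le (n := 2) (c := z)
    (f := regQuot χ) (C := K * y ^ 5 / y ^ 16) hρ0
    (DifferentiableOn.diffContOnCl_ball (U := Metric.closedBall z ρ)
      (fun w hw ↦ (hU w hw).differentiableWithinAt) le_rfl)
    fun w hw ↦ hbd w (Metric.sphere_subset_closedBall hw)
  refine hcau.trans ?_
  have : (Nat.factorial 2 : ℝ) * (K * y ^ 5 / y ^ 16) / ρ ^ 2 = 32 * K * A ^ 2 / c ^ 2 / y := by
    rw [hρ, Nat.factorial_two]; push_cast; field_simp; ring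
  rw [this]
  exact div_le_self (by positivity) hy1

lemma exists_norm_iteratedDeriv_regQuot_le :
    ∃ B : ℝ, 0 ≤ B ∧ ∀ z : ℂ, 0 < z.re → z.re ≤ 1 → ‖iteratedDeriv 2 (regQuot χ) z‖ ≤ B := by
  obtain ⟨B, hB, h⟩ := exists_norm_iteratedDeriv_regQuot_le_of_le_im χ
  have hcomp : IsCompact (Set.Icc (0 : ℝ) 1 ×ℂ Set.Icc (-3 : ℝ) 3) :=
    isCompact_Icc.reProdIm isCompact_Icc
  have hcont : ContinuousOn (iteratedDeriv 2 (regQuot χ)) (Set.Icc (0 : ℝ) 1 ×ℂ Set.Icc (-3 : ℝ) 3) := by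
    have h1 := (((differentiableOn_regQuot χ).deriv (isOpen_setOf_entireL_ne_zero χ)).deriv
      (isOpen_setOf_entireL_ne_zero χ)).continuousOn
    rw [iteratedDeriv_succ, iteratedDeriv_one]
    exact h1.mono fun z hz ↦ setOf_zero_le_re_subset χ hz.1.1
  obtain ⟨B', hB'⟩ := hcomp.exists_bound_of_continuousOn hcont
  refine ⟨max B B', le_max_of_le_left hB, fun z h1 h2 ↦ ?_⟩
  rcases le_total 3 |z.im| with h3 | h3
  · exact (h z h1.le h2 h3).trans (le_max_left _ _)
  · exact (hB' z ⟨⟨h1.le, h2⟩, abs_le.mp h3⟩).trans (le_max_right _ _)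

end RegularPart

section LaplaceTransform

/-- Functions supported on `(0, ∞)` whose Laplace transform converges in the right half-plane. -/
def HasLaplace (g : ℝ → ℂ) : Prop :=
  (∀ u ≤ 0, g u = 0) ∧ ∀ r : ℝ, 0 < r → Integrable fun u : ℝ ↦ (Real.exp (-(r * u)) : ℂ) * g u

/-- The Laplace transform. -/
noncomputable def laplace (g : ℝ → ℂ) (z : ℂ) : ℂ := ∫ u : ℝ, cexp (-(z * u)) * g u

lemma norm_cexp_neg_mul (z : ℂ) (u : ℝ) : ‖cexp (-(z * u))‖ = Real.exp (-(z.re * u)) := by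
  rw [norm_exp]; simp

lemma HasLaplace.integrable {g : ℝ → ℂ} (hg : HasLaplace g) {z : ℂ} (hz : 0 < z.re) :
    Integrable fun u : ℝ ↦ cexp (-(z * u)) * g u := by
  have h := (hg.2 _ hz).bdd_mul (f := fun u : ℝ ↦ cexp (-((z.im * I) * u))) (c := 1)
    (by fun_prop) (Eventually.of_forall fun u ↦ by rw [norm_cexp_neg_mul]; simp)
  refine h.congr (Eventually.of_forall fun u ↦ ?_)
  simp only
  rw [← mul_assoc, ofReal_exp, ← Complex.exp_add]
  congr 2
  nth_rewrite 3 [← re_add_im z]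
  push_cast
  ring

lemma HasLaplace.id_mul {g : ℝ → ℂ} (hg : HasLaplace g) : HasLaplace fun u ↦ u * g u := by
  refine ⟨fun u hu ↦ by simp [hg.1 u hu], fun r hr ↦ ?_⟩
  have h := hg.2 (r / 2) (by positivity)
  refine (h.norm.const_mul (2 / r)).mono' ?_ (Eventually.of_forall fun u ↦ ?_)
  · have h1 : AEStronglyMeasurable (fun u : ℝ ↦ (u * Real.exp (-(r / 2 * u)) : ℂ)) volume :=
      (Continuous.aestronglyMeasurable (by fun_prop))
    refine (h1.mul h.aestronglyMeasurable).congr (Eventually.of_forall fun u ↦ ?_)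
    have : Real.exp (-(r * u)) = Real.exp (-(r / 2 * u)) * Real.exp (-(r / 2 * u)) := by
      rw [← Real.exp_add]; ring_nf
    simp only [Pi.mul_apply]
    rw [this]; push_cast; ring
  · rcases le_or_gt u 0 with hu | hu
    · simp [hg.1 u hu]
    have h1 : r / 2 * u ≤ Real.exp (r / 2 * u) := by
      linarith [Real.add_one_le_exp (r / 2 * u)]
    have h2 : u * Real.exp (-(r * u)) ≤ 2 / r * Real.exp (-(r / 2 * u)) := by
      have : Real.exp (-(r / 2 * u)) = Real.exp (-(r * u)) * Real.exp (r / 2 * u) := by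
        rw [← Real.exp_add]; ring_nf
      rw [this]
      have h3 : u ≤ 2 / r * Real.exp (r / 2 * u) := by
        calc u = 2 / r * (r / 2 * u) := by field_simp
          _ ≤ _ := by gcongr
      nlinarith [Real.exp_pos (-(r * u))]
    simp only [norm_mul, norm_real, Real.norm_eq_abs, abs_of_pos hu, Real.abs_exp]
    calc Real.exp (-(r * u)) * (u * ‖g u‖) = (u * Real.exp (-(r * u))) * ‖g u‖ := by ring
      _ ≤ (2 / r * Real.exp (-(r / 2 * u))) * ‖g u‖ := by gcongr
      _ = _ := by ring

lemma HasLaplace.hasDerivAt {g : ℝ → ℂ} (hg : HasLaplace g) {z : ℂ} (hz : 0 < z.re) :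
    HasDerivAt (laplace g) (-(laplace (fun u ↦ u * g u) z)) z := by
  have h := hasDerivAt_integral_of_dominated_loc_of_deriv_le (μ := volume) (x₀ := z)
    (s := {w : ℂ | z.re / 2 < w.re}) (F := fun (w : ℂ) (u : ℝ) ↦ cexp (-(w * u)) * g u)
    (F' := fun (w : ℂ) (u : ℝ) ↦ -(cexp (-(w * u)) * (u * g u)))
    (bound := fun u ↦ ‖(Real.exp (-(z.re / 2 * u)) : ℂ) * (u * g u)‖)
    ((isOpen_lt continuous_const continuous_re).mem_nhds (by simp; linarith))
    ?_ (hg.integrable hz) (hg.id_mul.integrable hz).neg.aestronglyMeasurable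
    (Eventually.of_forall fun u w hw ↦ ?_)
    (hg.id_mul.2 (z.re / 2) (by positivity)).norm
    (Eventually.of_forall fun u w hw ↦ ?_)
  · refine h.2.congr_deriv ?_
    rw [integral_neg, laplace]
  · filter_upwards [(isOpen_lt continuous_const continuous_re).mem_nhds hz] with w hw
    exact (hg.integrable hw).aestronglyMeasurable
  · rcases le_or_gt u 0 with hu | hu
    · simp [hg.1 u hu]
    have e : ‖(Real.exp (-(z.re / 2 * u)) : ℂ) * (u * g u)‖ =
        Real.exp (-(z.re / 2 * u)) * ‖u * g u‖ := by
      rw [norm_mul, norm_real, Real.norm_eq_abs, Real.abs_exp]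
    rw [norm_neg, norm_mul, norm_cexp_neg_mul, e]
    have : z.re / 2 < w.re := hw
    gcongr
  · have h1 : HasDerivAt (fun w : ℂ ↦ -(w * u)) (-(1 * (u : ℂ))) w :=
      ((hasDerivAt_id w).mul_const (u : ℂ)).neg
    refine (h1.cexp.mul_const (g u)).congr_deriv ?_
    ring

lemma hasLaplace_indicator_one : HasLaplace (Set.indicator (Set.Ioi 0) 1) := by
  refine ⟨fun u hu ↦ by simp [hu], fun r hr ↦ ?_⟩
  have h := (integrableOn_exp_mul_complex_Ioi (a := -r) (by simpa) 0).integrable_indicator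
    measurableSet_Ioi
  refine h.congr (Eventually.of_forall fun u ↦ ?_)
  by_cases hu : u ∈ Set.Ioi (0 : ℝ) <;> simp [hu]

lemma HasLaplace.of_norm_le {g : ℝ → ℂ} (hm : Measurable g) (h0 : ∀ u ≤ 0, g u = 0) {C : ℝ}
    (h : ∀ u > 0, ‖g u‖ ≤ C * (1 + u + u ^ 2)) : HasLaplace g := by
  refine ⟨h0, fun r hr ↦ ?_⟩
  have i0 := hasLaplace_indicator_one
  have i1 := i0.id_mul
  have i2 := i1.id_mul
  refine ((((i0.2 r hr).norm.add (i1.2 r hr).norm).add (i2.2 r hr).norm).const_mul C).mono'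
    (by fun_prop) (Eventually.of_forall fun u ↦ ?_)
  rcases le_or_gt u 0 with hu | hu
  · simp [h0 u hu, not_lt.mpr hu]
  · have := h u hu
    simp only [Pi.add_apply, norm_mul, norm_real, Real.norm_eq_abs, Real.abs_exp, Set.mem_Ioi, hu,
      Set.indicator_of_mem, Pi.one_apply, norm_one, abs_of_pos hu]
    nlinarith [Real.exp_pos (-(r * u))]

lemma laplace_indicator_one {z : ℂ} (hz : 0 < z.re) :
    laplace (Set.indicator (Set.Ioi 0) 1) z = 1 / z := by
  have h := integral_exp_mul_complex_Ioi (a := -z) (by simpa) 0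
  rw [← integral_indicator measurableSet_Ioi] at h
  unfold laplace
  convert h using 1
  · congr 1 with u
    by_cases hu : u ∈ Set.Ioi (0 : ℝ) <;> simp [hu]
  · simp

lemma laplace_id_mul_indicator_one {z : ℂ} (hz : 0 < z.re) :
    laplace (fun u ↦ u * Set.indicator (Set.Ioi 0) 1 u) z = 1 / z ^ 2 := by
  have hz0 : z ≠ 0 := by rintro rfl; simp at hz
  have h1 := hasLaplace_indicator_one.hasDerivAt hz
  have h2 : HasDerivAt (fun z : ℂ ↦ z⁻¹) (-(z ^ 2)⁻¹) z := hasDerivAt_inv hz0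
  have h3 : laplace (Set.indicator (Set.Ioi 0) 1) =ᶠ[𝓝 z] fun z ↦ z⁻¹ := by
    filter_upwards [(isOpen_lt continuous_const continuous_re).mem_nhds hz] with w hw
    rw [laplace_indicator_one hw, one_div]
  have := h1.unique (h2.congr_of_eventuallyEq h3)
  rw [neg_inj] at this
  rw [this, one_div]

/-- The weighted partial sums `∑ χ(n) Λ(n) / n`. -/
noncomputable def charSum {q : ℕ} (χ : DirichletCharacter ℂ q) (N : ℕ) : ℂ :=
  ∑ n ∈ Icc 1 N, χ n * (ArithmeticFunction.vonMangoldt n : ℂ) / n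

/-- The error term of the weighted partial sums, in the logarithmic variable. -/
noncomputable def logError {q : ℕ} [NeZero q] (χ : DirichletCharacter ℂ q) (u : ℝ) : ℂ :=
  if 0 < u then charSum χ ⌊Real.exp u⌋₊ - poleOrder χ * u - regPart χ 0 else 0

variable {q : ℕ} [NeZero q] (χ : DirichletCharacter ℂ q)

omit [NeZero q] in
lemma sum_norm_le (N : ℕ) :
    ∑ n ∈ Icc 1 N, ‖χ n * (ArithmeticFunction.vonMangoldt n : ℂ) / n‖ ≤
      Real.log N * (1 + Real.log N) := by
  have h1 := harmonic_le_one_add_log N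
  rw [harmonic_eq_sum_Icc] at h1
  push_cast at h1
  have h0 : 0 ≤ Real.log N := Real.log_natCast_nonneg N
  calc _ ≤ ∑ n ∈ Icc 1 N, Real.log N * (n : ℝ)⁻¹ := by
        refine sum_le_sum fun n hn ↦ ?_
        rw [mem_Icc] at hn
        have hn0 : (0 : ℝ) < n := by exact_mod_cast hn.1
        rw [norm_div, norm_mul, norm_natCast, div_eq_mul_inv, norm_real, Real.norm_eq_abs,
          abs_of_nonneg ArithmeticFunction.vonMangoldt_nonneg]
        gcongr
        calc _ ≤ 1 * ArithmeticFunction.vonMangoldt n := by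
              gcongr
              exact χ.norm_le_one _
          _ ≤ Real.log n := by rw [one_mul]; exact ArithmeticFunction.vonMangoldt_le_log
          _ ≤ _ := Real.log_le_log hn0 (by exact_mod_cast hn.2)
    _ = Real.log N * ∑ n ∈ Icc 1 N, (n : ℝ)⁻¹ := by rw [mul_sum]
    _ ≤ _ := by gcongr

omit [NeZero q] in
lemma measurable_charSum_floor : Measurable fun u : ℝ ↦ charSum χ ⌊Real.exp u⌋₊ :=
  (measurable_from_nat (f := charSum χ)).comp (Nat.measurable_floor.comp Real.measurable_exp)

omit [NeZero q] in
lemma norm_charSum_floor_le {u : ℝ} (hu : 0 ≤ u) :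
    ‖charSum χ ⌊Real.exp u⌋₊‖ ≤ u * (1 + u) := by
  have h1 : 1 ≤ Real.exp u := Real.one_le_exp hu
  have h2 : 1 ≤ ⌊Real.exp u⌋₊ := Nat.one_le_floor_iff _ |>.mpr h1
  refine ((norm_sum_le _ _).trans (sum_norm_le χ _)).trans ?_
  have h3 : Real.log ⌊Real.exp u⌋₊ ≤ u := by
    rw [Real.log_le_iff_le_exp (by exact_mod_cast h2)]
    exact Nat.floor_le (Real.exp_pos u).le
  have := Real.log_natCast_nonneg ⌊Real.exp u⌋₊
  gcongr

/-- The partial sums of the twisted von Mangoldt function, in the logarithmic variable. -/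
noncomputable def logSum {q : ℕ} (χ : DirichletCharacter ℂ q) : ℝ → ℂ :=
  Set.indicator (Set.Ioi 0) fun u ↦ charSum χ ⌊Real.exp u⌋₊

omit [NeZero q] in
lemma hasLaplace_logSum : HasLaplace (logSum χ) := by
  refine .of_norm_le (C := 1) ((measurable_charSum_floor χ).indicator measurableSet_Ioi)
    (fun u hu ↦ by simp [logSum, hu]) fun u hu ↦ ?_
  simp only [logSum, Set.mem_Ioi, hu, Set.indicator_of_mem]
  refine (norm_charSum_floor_le χ hu.le).trans ?_
  nlinarith

lemma logError_eq : logError χ = fun u ↦ logSum χ u -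
    (poleOrder χ : ℂ) * (u * Set.indicator (Set.Ioi 0) 1 u) -
    regPart χ 0 * Set.indicator (Set.Ioi 0) 1 u := by
  ext u
  by_cases hu : 0 < u <;> simp [logError, logSum, hu]

lemma hasLaplace_logError : HasLaplace (logError χ) := by
  rw [logError_eq]
  refine ⟨fun u hu ↦ by simp [(hasLaplace_logSum χ).1 u hu, hu], fun r hr ↦ ?_⟩
  refine ((((hasLaplace_logSum χ).2 r hr).sub
    ((hasLaplace_indicator_one.id_mul.2 r hr).const_mul (poleOrder χ : ℂ))).sub
    ((hasLaplace_indicator_one.2 r hr).const_mul (regPart χ 0))).congr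
    (Eventually.of_forall fun u ↦ ?_)
  simp only [Pi.sub_apply]
  ring

lemma LSeries_div_natCast (f : ℕ → ℂ) (z : ℂ) :
    LSeries (fun n ↦ f n / n) z = LSeries f (1 + z) := by
  refine tsum_congr fun n ↦ ?_
  rcases eq_or_ne n 0 with rfl | hn
  · simp
  · have : (n : ℂ) ≠ 0 := by exact_mod_cast hn
    rw [LSeries.term_of_ne_zero hn, LSeries.term_of_ne_zero hn, cpow_add _ _ this, cpow_one,
      div_div]

omit [NeZero q] in
lemma isBigO_sum_norm {r : ℝ} (hr : 0 < r) :
    (fun N : ℕ ↦ ∑ n ∈ Icc 1 N, ‖χ n * (ArithmeticFunction.vonMangoldt n : ℂ) / n‖) =O[atTop]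
      fun N ↦ (N : ℝ) ^ r := by
  have h1 : (fun x : ℝ ↦ Real.log x) =O[atTop] fun x ↦ x ^ (r / 2) :=
    (isLittleO_log_rpow_atTop (by positivity)).isBigO
  have h2 : (fun x : ℝ ↦ (1 : ℝ)) =O[atTop] fun x ↦ x ^ (r / 2) := by
    rw [isBigO_const_left_iff_pos_le_norm one_ne_zero]
    refine ⟨1, one_pos, ?_⟩
    filter_upwards [eventually_ge_atTop 1] with x hx
    rw [Real.norm_of_nonneg (by positivity)]
    exact Real.one_le_rpow hx (by positivity)
  have h3 : (fun x : ℝ ↦ Real.log x * (1 + Real.log x)) =O[atTop] fun x ↦ x ^ r := by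
    refine (h1.mul (h2.add h1)).congr' .rfl ?_
    filter_upwards [eventually_gt_atTop 0] with x hx
    rw [← Real.rpow_add hx]; ring_nf
  refine IsBigO.trans (.of_bound 1 ?_) (h3.comp_tendsto tendsto_natCast_atTop_atTop)
  filter_upwards [eventually_ge_atTop 1] with N hN
  rw [one_mul, Real.norm_of_nonneg (by positivity)]
  exact (sum_norm_le χ N).trans (Real.le_norm_self _)

lemma laplace_logSum {z : ℂ} (hz : 0 < z.re) :
    laplace (logSum χ) z = -(deriv (LFunction χ) (1 + z) / LFunction χ (1 + z)) / z := by
  have hz0 : z ≠ 0 := by rintro rfl; simp at hz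
  have hz1 : 1 < (1 + z).re := by simpa
  have h1 := LSeries_eq_mul_integral' (fun n : ℕ ↦ χ n * (ArithmeticFunction.vonMangoldt n : ℂ) / n)
    (r := z.re / 2) (by positivity) (s := z) (by linarith) (isBigO_sum_norm χ (by positivity))
  have h2 := LSeries_div_natCast (fun n : ℕ ↦ χ n * (ArithmeticFunction.vonMangoldt n : ℂ)) z
  rw [h2] at h1
  have h3 := LSeries_twist_vonMangoldt_eq χ hz1
  rw [← LFunction_eq_LSeries χ hz1, ← deriv_LFunction_eq_deriv_LSeries χ hz1] at h3
  have h4 : LSeries (fun n : ℕ ↦ χ n * (ArithmeticFunction.vonMangoldt n : ℂ)) (1 + z) =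
    -deriv (LFunction χ) (1 + z) / LFunction χ (1 + z) := h3
  rw [h4] at h1
  rw [← neg_div, h1, mul_div_cancel_left₀ _ hz0]
  have himg : Real.exp '' Set.Ioi 0 = Set.Ioi 1 := by
    ext t
    constructor
    · rintro ⟨u, hu, rfl⟩; exact Real.one_lt_exp_iff.mpr hu
    · intro ht
      have ht : 1 < t := ht
      exact ⟨Real.log t, Real.log_pos ht, Real.exp_log (by linarith)⟩
  rw [← himg, integral_image_eq_integral_abs_deriv_smul measurableSet_Ioi
    (fun u _ ↦ (Real.hasDerivAt_exp u).hasDerivWithinAt) Real.exp_injective.injOn,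
    ← integral_indicator measurableSet_Ioi]
  unfold laplace logSum
  congr 1 with u
  by_cases hu : u ∈ Set.Ioi (0 : ℝ)
  · simp only [hu, Set.indicator_of_mem, Real.abs_exp, real_smul]
    rw [cpow_def_of_ne_zero (by simp), ← ofReal_log (Real.exp_pos u).le,
      Real.log_exp, ofReal_exp]
    unfold charSum
    rw [mul_left_comm, ← Complex.exp_add, mul_comm]
    congr 2
    ring
  · simp [hu]

lemma laplace_logError {z : ℂ} (hz : 0 < z.re) : laplace (logError χ) z = regQuot χ z := by
  have hz0 : z ≠ 0 := by rintro rfl; simp at hz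
  have h1 : LFunction χ (1 + z) ≠ 0 :=
    LFunction_ne_zero_of_one_le_re χ (.inr (by simpa using hz0)) (by simp; linarith)
  rw [regQuot_eq χ hz0 h1, logError_eq]
  have i1 := (hasLaplace_logSum χ).integrable hz
  have i2 := (hasLaplace_indicator_one.id_mul.integrable hz).const_mul (poleOrder χ : ℂ)
  have i3 := (hasLaplace_indicator_one.integrable hz).const_mul (regPart χ 0)
  have : laplace (fun u ↦ logSum χ u -
    (poleOrder χ : ℂ) * (u * Set.indicator (Set.Ioi 0) 1 u) -
    regPart χ 0 * Set.indicator (Set.Ioi 0) 1 u) z = laplace (logSum χ) z -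
    poleOrder χ * laplace (fun u ↦ u * Set.indicator (Set.Ioi 0) 1 u) z -
    regPart χ 0 * laplace (Set.indicator (Set.Ioi 0) 1) z := by
    unfold laplace
    rw [← integral_const_mul, ← integral_const_mul]
    refine Eq.trans ?_ ((integral_sub (i1.sub i2) i3).trans
      (congrArg₂ (· - ·) (integral_sub i1 i2) rfl))
    congr 1 with u
    simp only [Pi.sub_apply]
    ring
  rw [this, laplace_logSum χ hz, laplace_id_mul_indicator_one hz, laplace_indicator_one hz]
  field_simp

lemma laplace_sq_mul_logError {z : ℂ} (hz : 0 < z.re) :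
    laplace (fun u ↦ u * (u * logError χ u)) z = iteratedDeriv 2 (regQuot χ) z := by
  have hU : IsOpen {w : ℂ | 0 < w.re} := isOpen_lt continuous_const continuous_re
  have h1 : ∀ w : ℂ, 0 < w.re →
      deriv (regQuot χ) w = -laplace (fun u ↦ u * logError χ u) w := fun w hw ↦ by
    refine (((hasLaplace_logError χ).hasDerivAt hw).congr_of_eventuallyEq ?_).deriv
    filter_upwards [hU.mem_nhds hw] with v hv using (laplace_logError χ hv).symm
  rw [iteratedDeriv_succ, iteratedDeriv_one]
  have h2 := ((hasLaplace_logError χ).id_mul.hasDerivAt hz).neg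
  rw [neg_neg] at h2
  refine (h2.congr_of_eventuallyEq ?_).deriv.symm
  filter_upwards [hU.mem_nhds hz] with v hv using h1 v hv

end LaplaceTransform

section Tauberian

lemma exists_bump_eq_fourier : ∃ (w : ℝ → ℝ) (k : ℝ → ℂ) (C : ℝ), Continuous w ∧
    (∀ y, 0 ≤ w y) ∧ (∀ y, w y ≤ C) ∧ (∀ y, y ∉ Set.Icc 0 1 → w y = 0) ∧ ∫ y, w y = 1 ∧
    Integrable k ∧ ∀ y, (w y : ℂ) = ∫ ξ : ℝ, cexp ((-2 * Real.pi * ξ * y : ℝ) * I) * k ξ := by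
  let φ : ContDiffBump (1 / 2 : ℝ) := ⟨1 / 4, 1 / 2, by norm_num, by norm_num⟩
  have hc : Continuous (φ.normed volume) := φ.continuous_normed
  obtain ⟨C, hC⟩ := (φ.hasCompactSupport_normed (μ := volume)).exists_bound_of_continuous hc
  have h1 : HasCompactSupport fun y ↦ ((φ.normed volume y : ℝ) : ℂ) :=
    (φ.hasCompactSupport_normed (μ := volume)).comp_left (g := fun r : ℝ ↦ (r : ℂ)) (by simp)
  have h2 : ContDiff ℝ ((⊤ : ℕ∞) : WithTop ℕ∞) fun y ↦ ((φ.normed volume y : ℝ) : ℂ) :=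
    Complex.ofRealCLM.contDiff.comp φ.contDiff_normed
  let W : SchwartzMap ℝ ℂ := h1.toSchwartzMap h2
  let k : SchwartzMap ℝ ℂ := FourierTransformInv.fourierInv W
  have hk : FourierTransform.fourier (k : ℝ → ℂ) = (W : ℝ → ℂ) := by
    rw [← SchwartzMap.fourier_coe]
    simp [k]
  refine ⟨φ.normed volume, k, C, hc, φ.nonneg_normed, fun y ↦ (Real.le_norm_self _).trans (hC y),
    fun y hy ↦ ?_, φ.integral_normed, k.integrable, fun y ↦ ?_⟩
  · by_contra h
    have : y ∈ Function.support (φ.normed volume) := h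
    rw [φ.support_normed_eq, Real.ball_eq_Ioo] at this
    apply hy
    have h3 : (φ.rOut : ℝ) = 1 / 2 := rfl
    rw [h3] at this
    constructor <;> linarith [this.1, this.2]
  · change W y = _
    rw [← hk, Real.fourier_real_eq_integral_exp_smul]
    rfl

section smoothing

variable {G : ℝ → ℂ} (hG : HasLaplace G) {w : ℝ → ℝ} (hwc : Continuous w) (hw0 : ∀ y, 0 ≤ w y)
  {C : ℝ} (hwC : ∀ y, w y ≤ C) (hws : ∀ y, y ∉ Set.Icc 0 1 → w y = 0) {T : ℝ} (hT : 0 < T) (v : ℝ)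

include hws hT in
lemma bump_eq_zero {x : ℝ} (hx : x ∉ Set.Icc v (v + 1 / T)) : w (T * (x - v)) = 0 := by
  refine hws _ fun h ↦ hx ⟨?_, ?_⟩
  · have := (mul_nonneg_iff_of_pos_left hT).mp h.1; linarith
  · have := (le_div_iff₀' hT).mpr h.2; linarith

include hwc hws hT in
lemma integrable_continuous_mul_bump {f : ℝ → ℝ} (hf : Continuous f) :
    Integrable fun x ↦ f x * w (T * (x - v)) := by
  refine Continuous.integrable_of_hasCompactSupport (by fun_prop) ?_
  refine HasCompactSupport.intro (K := Set.Icc v (v + 1 / T)) isCompact_Icc fun x hx ↦ ?_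
  rw [bump_eq_zero hws hT v hx, mul_zero]

include hG hwc hw0 hwC hws hT in
lemma HasLaplace.integrable_mul_bump : Integrable fun x ↦ G x * (w (T * (x - v)) : ℂ) := by
  have h := hG.2 1 one_pos
  have hC : 0 ≤ C := (hw0 0).trans (hwC 0)
  have h2 := h.bdd_mul (f := fun x : ℝ ↦ ((Real.exp x * w (T * (x - v)) : ℝ) : ℂ))
    (c := Real.exp (v + 1 / T) * C)
    (Continuous.aestronglyMeasurable (by fun_prop)) (Eventually.of_forall fun x ↦ ?_)
  · refine h2.congr (Eventually.of_forall fun x ↦ ?_)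
    simp only
    have : (Real.exp x : ℂ) * Real.exp (-(1 * x)) = 1 := by
      rw [← ofReal_mul, ← Real.exp_add]; simp
    rw [ofReal_mul]
    linear_combination (w (T * (x - v)) * G x : ℂ) * this
  · rw [norm_real, Real.norm_eq_abs, abs_mul, Real.abs_exp, abs_of_nonneg (hw0 _)]
    by_cases hx : x ∈ Set.Icc v (v + 1 / T)
    · gcongr
      · exact hw0 _
      · exact hx.2
      · exact hwC _
    · rw [bump_eq_zero hws hT v hx, mul_zero]; positivity

include hT in
lemma integral_bump (h1 : ∫ y, w y = 1) : ∫ x, w (T * (x - v)) = 1 / T := by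
  rw [integral_sub_right_eq_self (fun x ↦ w (T * x)) v, Measure.integral_comp_mul_left, h1,
    abs_of_pos (inv_pos.mpr hT)]
  simp

include hG hwc hw0 hwC hws hT in
lemma HasLaplace.norm_integral_mul_bump_le {B : ℝ}
    (hB : ∀ z : ℂ, 0 < z.re → z.re ≤ 1 → ‖laplace G z‖ ≤ B) {k : ℝ → ℂ} (hk : Integrable k)
    (hwk : ∀ y, (w y : ℂ) = ∫ ξ : ℝ, cexp ((-2 * Real.pi * ξ * y : ℝ) * I) * k ξ) :
    ‖∫ x, G x * (w (T * (x - v)) : ℂ)‖ ≤ B * ∫ ξ, ‖k ξ‖ := by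
  have hi := hG.integrable_mul_bump hwc hw0 hwC hws hT v
  have hσ : ∀ σ : ℝ, 0 < σ → σ ≤ 1 →
      ‖∫ x, (Real.exp (-(σ * x)) : ℂ) * (G x * (w (T * (x - v)) : ℂ))‖ ≤ B * ∫ ξ, ‖k ξ‖ := by
    intro σ h0 h1
    have e1 : ∀ x : ℝ, (Real.exp (-(σ * x)) : ℂ) * (G x * (w (T * (x - v)) : ℂ)) =
        ∫ ξ : ℝ, cexp ((-2 * Real.pi * ξ * (T * (x - v)) : ℝ) * I) *
          ((Real.exp (-(σ * x)) * G x) * k ξ) := fun x ↦ by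
      rw [hwk, ← mul_assoc, ← integral_const_mul]
      congr 1 with ξ
      ring
    have hint : Integrable (Function.uncurry fun x ξ : ℝ ↦
        cexp ((-2 * Real.pi * ξ * (T * (x - v)) : ℝ) * I) *
          ((Real.exp (-(σ * x)) * G x) * k ξ)) (volume.prod volume) := by
      refine ((hG.2 σ h0).mul_prod hk).bdd_mul (c := 1)
        (f := fun p : ℝ × ℝ ↦ cexp ((-2 * Real.pi * p.2 * (T * (p.1 - v)) : ℝ) * I))
        (Continuous.aestronglyMeasurable (by fun_prop)) (Eventually.of_forall fun p ↦ ?_)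
      rw [norm_exp_ofReal_mul_I]
    have e2 : ∀ ξ : ℝ, ∫ x : ℝ, cexp ((-2 * Real.pi * ξ * (T * (x - v)) : ℝ) * I) *
          ((Real.exp (-(σ * x)) * G x) * k ξ) =
        cexp ((2 * Real.pi * ξ * (T * v) : ℝ) * I) * laplace G (σ + 2 * Real.pi * ξ * T * I) *
          k ξ := fun ξ ↦ by
      rw [laplace, ← integral_const_mul, ← integral_mul_const]
      congr 1 with x
      have : cexp ((-2 * Real.pi * ξ * (T * (x - v)) : ℝ) * I) * (Real.exp (-(σ * x)) : ℂ) =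
          cexp ((2 * Real.pi * ξ * (T * v) : ℝ) * I) *
            cexp (-((σ + 2 * Real.pi * ξ * T * I) * x)) := by
        rw [ofReal_exp, ← Complex.exp_add, ← Complex.exp_add]
        congr 1
        push_cast
        ring
      linear_combination G x * k ξ * this
    simp_rw [e1]
    rw [integral_integral_swap hint]
    simp_rw [e2]
    rw [← integral_const_mul]
    refine norm_integral_le_of_norm_le (hk.norm.const_mul B) (Eventually.of_forall fun ξ ↦ ?_)
    rw [norm_mul, norm_mul, norm_exp_ofReal_mul_I, one_mul]
    gcongr
    exact hB _ (by simpa using h0) (by simpa using h1)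
  have hlim : Tendsto (fun n : ℕ ↦ ∫ x, (Real.exp (-((1 / ((n : ℝ) + 1)) * x)) : ℂ) *
      (G x * (w (T * (x - v)) : ℂ))) atTop (𝓝 (∫ x, G x * (w (T * (x - v)) : ℂ))) := by
    refine tendsto_integral_of_dominated_convergence (fun x ↦ ‖G x * (w (T * (x - v)) : ℂ)‖)
      (fun n ↦ ?_) hi.norm (fun n ↦ Eventually.of_forall fun x ↦ ?_)
      (Eventually.of_forall fun x ↦ ?_)
    · exact (Continuous.aestronglyMeasurable (by fun_prop)).mul hi.aestronglyMeasurable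
    · rcases le_or_gt x 0 with hx | hx
      · simp [hG.1 x hx]
      rw [norm_mul, norm_real, Real.norm_eq_abs, Real.abs_exp]
      refine mul_le_of_le_one_left (norm_nonneg _) (Real.exp_le_one_iff.mpr ?_)
      have : 0 ≤ 1 / ((n : ℝ) + 1) * x := by positivity
      linarith
    · have h1 : Tendsto (fun n : ℕ ↦ ((Real.exp (-((1 / ((n : ℝ) + 1)) * x)) : ℝ) : ℂ)) atTop
          (𝓝 ((Real.exp (-(0 * x)) : ℝ) : ℂ)) :=
        (continuous_ofReal.tendsto _).comp ((Real.continuous_exp.tendsto _).comp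
          ((tendsto_one_div_add_atTop_nhds_zero_nat.mul_const x).neg))
      simpa using h1.mul_const (G x * (w (T * (x - v)) : ℂ))
  refine le_of_tendsto hlim.norm (Eventually.of_forall fun n ↦ hσ _ (by positivity) ?_)
  rw [div_le_one (by positivity)]
  have : (0 : ℝ) ≤ n := by positivity
  linarith

end smoothing

variable {q : ℕ} [NeZero q] (χ : DirichletCharacter ℂ q)

omit [NeZero q] in
lemma norm_le_re_one_apply (a : ZMod q) :
    ‖χ a‖ ≤ ((1 : DirichletCharacter ℂ q) a).re := by
  by_cases ha : IsUnit a
  · rw [MulChar.one_apply ha]; simpa using χ.norm_le_one a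
  · rw [MulChar.map_nonunit _ ha, MulChar.map_nonunit _ ha]; simp

omit [NeZero q] in
lemma norm_charSum_sub_le {M N : ℕ} (h : M ≤ N) :
    ‖charSum χ N - charSum χ M‖ ≤
      (charSum (1 : DirichletCharacter ℂ q) N - charSum (1 : DirichletCharacter ℂ q) M).re := by
  have e : ∀ ψ : DirichletCharacter ℂ q, charSum ψ N - charSum ψ M =
      ∑ n ∈ Ioc M N, ψ n * (ArithmeticFunction.vonMangoldt n : ℂ) / n := fun ψ ↦ by
    have hI : ∀ N, Icc 1 N = Ioc 0 N := fun N ↦ rfl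
    unfold charSum
    rw [sub_eq_iff_eq_add', hI, hI, Finset.sum_Ioc_consecutive _ (Nat.zero_le _) h]
  rw [e, e, re_sum]
  refine norm_sum_le_of_le _ fun n _ ↦ ?_
  have h0 : (0 : ℝ) ≤ ArithmeticFunction.vonMangoldt n := ArithmeticFunction.vonMangoldt_nonneg
  rw [norm_div, norm_mul, _root_.norm_natCast, norm_real, Real.norm_of_nonneg h0, ← ofReal_natCast,
    div_ofReal_re, re_mul_ofReal]
  gcongr
  exact norm_le_re_one_apply χ _

lemma norm_logError_sub_le {u x : ℝ} (hu : 0 < u) (hux : u ≤ x) :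
    ‖(logError χ x - logError χ u) + poleOrder χ * (x - u)‖ ≤
      (logError (1 : DirichletCharacter ℂ q) x - logError (1 : DirichletCharacter ℂ q) u).re
        + (x - u) := by
  have hx : 0 < x := hu.trans_le hux
  have h := norm_charSum_sub_le χ (Nat.floor_mono (Real.exp_le_exp.mpr hux))
  have e1 : (logError χ x - logError χ u) + poleOrder χ * (x - u) =
      charSum χ ⌊Real.exp x⌋₊ - charSum χ ⌊Real.exp u⌋₊ := by
    simp only [logError, hx, hu, if_true]; ring
  have e2 : (logError (1 : DirichletCharacter ℂ q) x - logError (1 : DirichletCharacter ℂ q) u).re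
        + (x - u) = (charSum (1 : DirichletCharacter ℂ q) ⌊Real.exp x⌋₊ -
          charSum (1 : DirichletCharacter ℂ q) ⌊Real.exp u⌋₊).re := by
    simp [logError, hx, hu, poleOrder]
    ring
  rw [e1, e2]
  exact h

lemma exists_smoothing_bound {w : ℝ → ℝ} {k : ℝ → ℂ} {C : ℝ} (hwc : Continuous w)
    (hw0 : ∀ y, 0 ≤ w y) (hwC : ∀ y, w y ≤ C) (hws : ∀ y, y ∉ Set.Icc 0 1 → w y = 0)
    (hk : Integrable k)
    (hwk : ∀ y, (w y : ℂ) = ∫ ξ : ℝ, cexp ((-2 * Real.pi * ξ * y : ℝ) * I) * k ξ) :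
    ∃ κ : ℝ, 0 ≤ κ ∧ ∀ T > 0, ∀ v : ℝ,
      Integrable (fun x : ℝ ↦ (x : ℂ) * (x * logError χ x) * (w (T * (x - v)) : ℂ)) ∧
      ‖∫ x : ℝ, (x : ℂ) * (x * logError χ x) * (w (T * (x - v)) : ℂ)‖ ≤ κ := by
  obtain ⟨B, hB, hB'⟩ := exists_norm_iteratedDeriv_regQuot_le χ
  have hG := (hasLaplace_logError χ).id_mul.id_mul
  refine ⟨B * ∫ ξ, ‖k ξ‖, mul_nonneg hB (integral_nonneg fun _ ↦ norm_nonneg _),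
    fun T hT v ↦ ⟨hG.integrable_mul_bump hwc hw0 hwC hws hT v, ?_⟩⟩
  exact hG.norm_integral_mul_bump_le hwc hw0 hwC hws hT v
    (fun z h1 h2 ↦ by rw [laplace_sq_mul_logError χ h1]; exact hB' z h1 h2) hk hwk

lemma exists_abs_re_logError_one_le : ∃ C : ℝ, 0 ≤ C ∧ ∀ u : ℝ, 2 ≤ u →
    |(logError (1 : DirichletCharacter ℂ q) u).re| ≤ C / u := by
  obtain ⟨w, k, C, hwc, hw0, hwC, hws, hw1, hk, hwk⟩ := exists_bump_eq_fourier
  obtain ⟨κ, hκ, h⟩ := exists_smoothing_bound (1 : DirichletCharacter ℂ q) hwc hw0 hwC hws hk hwk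
  set A : ℝ → ℝ := fun u ↦ (logError (1 : DirichletCharacter ℂ q) u).re with hA
  have hmono : ∀ u x, 0 < u → u ≤ x → A u ≤ A x + (x - u) := fun u x hu hux ↦ by
    have := (norm_nonneg _).trans (norm_logError_sub_le (1 : DirichletCharacter ℂ q) hu hux)
    rw [sub_re] at this
    simp only [hA]; linarith
  have hre : ∀ T > 0, ∀ v : ℝ, Integrable (fun x ↦ x ^ 2 * A x * w (T * (x - v))) ∧
      |∫ x, x ^ 2 * A x * w (T * (x - v))| ≤ κ := fun T hT v ↦ by
    obtain ⟨h1, h2⟩ := h T hT v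
    have e : (fun x : ℝ ↦ ((x : ℂ) * (x * logError (1 : DirichletCharacter ℂ q) x) *
        (w (T * (x - v)) : ℂ)).re) = fun x ↦ x ^ 2 * A x * w (T * (x - v)) := by
      ext x
      rw [re_mul_ofReal, re_ofReal_mul, re_ofReal_mul]
      simp only [hA]; ring
    have h3 := h1.re
    have h4 : ∫ x, x ^ 2 * A x * w (T * (x - v)) = (∫ x : ℝ, (x : ℂ) *
        (x * logError (1 : DirichletCharacter ℂ q) x) * (w (T * (x - v)) : ℂ)).re := by
      rw [← e]; exact integral_re h1
    refine ⟨e ▸ h3, ?_⟩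
    rw [h4]
    exact (abs_re_le_norm _).trans h2
  refine ⟨4 * κ + 1, by positivity, fun u hu ↦ ?_⟩
  have hu0 : 0 < u := by linarith
  have hi : 1 / u ≤ 1 / 2 := one_div_le_one_div_of_le two_pos hu
  change |A u| ≤ _
  have hup : A u ≤ κ / u + 1 / u := by
    by_contra! hcon
    have hD : 0 < A u - 1 / u := by
      have : 0 ≤ κ / u := by positivity
      linarith
    obtain ⟨h1, h2⟩ := hre u hu0 u
    have h3 : ∫ x, u ^ 2 * (A u - 1 / u) * w (u * (x - u)) ≤ ∫ x, x ^ 2 * A x * w (u * (x - u)) := by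
      refine integral_mono (integrable_continuous_mul_bump hwc hws hu0 u continuous_const) h1
        fun x ↦ ?_
      by_cases hx : x ∈ Set.Icc u (u + 1 / u)
      · have := hmono u x hu0 hx.1
        have h5 : A u - 1 / u ≤ A x := by linarith [hx.2]
        have h6 := hx.1
        have := hw0 (u * (x - u))
        simp only
        gcongr
      · simp [bump_eq_zero hws hu0 u hx]
    rw [integral_const_mul, integral_bump hu0 u hw1] at h3
    have h4 : u ^ 2 * (A u - 1 / u) * (1 / u) = u * (A u - 1 / u) := by field_simp
    rw [h4] at h3
    have h5 : κ < u * (A u - 1 / u) := by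
      rw [← div_lt_iff₀' hu0]; linarith
    linarith [(abs_le.mp h2).2]
  have hlo : -(4 * κ / u + 1 / u) ≤ A u := by
    by_contra! hcon
    have hD : A u + 1 / u < 0 := by
      have : 0 ≤ 4 * κ / u := by positivity
      linarith
    obtain ⟨h1, h2⟩ := hre u hu0 (u - 1 / u)
    have h3 : ∫ x, x ^ 2 * A x * w (u * (x - (u - 1 / u))) ≤
        ∫ x, (u / 2) ^ 2 * (A u + 1 / u) * w (u * (x - (u - 1 / u))) := by
      refine integral_mono h1 (integrable_continuous_mul_bump hwc hws hu0 _ continuous_const)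
        fun x ↦ ?_
      by_cases hx : x ∈ Set.Icc (u - 1 / u) (u - 1 / u + 1 / u)
      · have hx2 : u / 2 ≤ x := by linarith [hx.1]
        have := hmono x u (by linarith) (by linarith [hx.2])
        have h5 : A x ≤ A u + 1 / u := by linarith [hx.1]
        have := hw0 (u * (x - (u - 1 / u)))
        simp only
        refine mul_le_mul_of_nonneg_right ?_ this
        have h6 : (u / 2) ^ 2 ≤ x ^ 2 := by gcongr
        nlinarith [sq_nonneg x]
      · simp only [bump_eq_zero hws hu0 _ hx, mul_zero, le_refl]
    rw [integral_const_mul, integral_bump hu0 _ hw1] at h3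
    have h4 : (u / 2) ^ 2 * (A u + 1 / u) * (1 / u) = u * (A u + 1 / u) / 4 := by
      field_simp; ring
    rw [h4] at h3
    have h5 : u * (A u + 1 / u) < -(4 * κ) := by
      rw [← lt_div_iff₀' hu0, neg_div]; linarith
    linarith [(abs_le.mp h2).1]
  rw [abs_le, add_div]
  constructor
  · linarith
  · have : κ / u ≤ 4 * κ / u := by gcongr; linarith
    linarith

lemma exists_norm_logError_le : ∃ C : ℝ, 0 ≤ C ∧ ∀ u : ℝ, 2 ≤ u → ‖logError χ u‖ ≤ C / u := by
  obtain ⟨w, k, C, hwc, hw0, hwC, hws, hw1, hk, hwk⟩ := exists_bump_eq_fourier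
  obtain ⟨κ, hκ, h⟩ := exists_smoothing_bound χ hwc hw0 hwC hws hk hwk
  obtain ⟨C₁, hC₁, h₁⟩ := exists_abs_re_logError_one_le (q := q)
  refine ⟨κ + (2 * C₁ + 2), by positivity, fun u hu ↦ ?_⟩
  have hu0 : 0 < u := by linarith
  obtain ⟨h2, h3⟩ := h u hu0 u
  set c := (2 * C₁ + 2) / u with hc
  set J := ∫ x, x ^ 2 * w (u * (x - u)) with hJ
  have hJi : Integrable fun x ↦ x ^ 2 * w (u * (x - u)) :=
    integrable_continuous_mul_bump hwc hws hu0 u (by fun_prop)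
  have hJu : u ≤ J := by
    have h4 : ∫ x, u ^ 2 * w (u * (x - u)) ≤ J := by
      refine integral_mono (integrable_continuous_mul_bump hwc hws hu0 u continuous_const) hJi
        fun x ↦ ?_
      by_cases hx : x ∈ Set.Icc u (u + 1 / u)
      · have h6 := hx.1
        have := hw0 (u * (x - u))
        simp only
        gcongr
      · simp [bump_eq_zero hws hu0 u hx]
    rw [integral_const_mul, integral_bump hu0 u hw1] at h4
    refine le_trans (le_of_eq ?_) h4
    field_simp
  have hvar : ∀ x ∈ Set.Icc u (u + 1 / u), ‖logError χ x - logError χ u‖ ≤ c := fun x hx ↦ by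
    have h4 := norm_logError_sub_le χ hu0 hx.1
    have h5 := (abs_le.mp (h₁ u hu)).1
    have h6 := (abs_le.mp (h₁ x (hu.trans hx.1))).2
    have h7 : C₁ / x ≤ C₁ / u := by gcongr; exact hx.1
    have h8 : ‖(poleOrder χ : ℂ) * (x - u)‖ ≤ x - u := by
      rw [norm_mul, norm_real, Real.norm_eq_abs, ← ofReal_sub, norm_real, Real.norm_eq_abs,
        abs_of_nonneg (sub_nonneg.mpr hx.1)]
      exact mul_le_of_le_one_left (sub_nonneg.mpr hx.1) (abs_poleOrder_le χ)
    have h9 := norm_sub_le ((logError χ x - logError χ u) + poleOrder χ * (x - u))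
      ((poleOrder χ : ℂ) * (x - u))
    rw [add_sub_cancel_right] at h9
    rw [sub_re] at h4
    have h10 : c = 2 * (C₁ / u) + 2 * (1 / u) := by rw [hc]; ring
    rw [neg_le_iff_add_nonneg] at h5
    linarith [hx.2]
  have hkey : logError χ u * J = (∫ x : ℝ, (x : ℂ) * (x * logError χ x) * (w (u * (x - u)) : ℂ)) -
      ∫ x : ℝ, ((x : ℂ) * (x * logError χ x) * (w (u * (x - u)) : ℂ) -
        logError χ u * ((x ^ 2 * w (u * (x - u)) : ℝ) : ℂ)) := by
    have hJi' : Integrable fun x ↦ ((x ^ 2 * w (u * (x - u)) : ℝ) : ℂ) := hJi.ofReal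
    have := integral_sub h2 (hJi'.const_mul (logError χ u))
    rw [this, integral_const_mul, integral_complex_ofReal]
    ring
  have hrem : ‖∫ x : ℝ, ((x : ℂ) * (x * logError χ x) * (w (u * (x - u)) : ℂ) -
        logError χ u * ((x ^ 2 * w (u * (x - u)) : ℝ) : ℂ))‖ ≤ c * J := by
    rw [hJ, ← integral_const_mul]
    refine norm_integral_le_of_norm_le (hJi.const_mul c) (Eventually.of_forall fun x ↦ ?_)
    have e : ((x : ℂ) * (x * logError χ x) * (w (u * (x - u)) : ℂ) -
        logError χ u * ((x ^ 2 * w (u * (x - u)) : ℝ) : ℂ)) =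
        (logError χ x - logError χ u) * ((x ^ 2 * w (u * (x - u)) : ℝ) : ℂ) := by
      push_cast; ring
    have h4 : 0 ≤ x ^ 2 * w (u * (x - u)) := mul_nonneg (sq_nonneg x) (hw0 _)
    rw [e, norm_mul, norm_real, Real.norm_of_nonneg h4]
    by_cases hx : x ∈ Set.Icc u (u + 1 / u)
    · exact mul_le_mul_of_nonneg_right (hvar x hx) h4
    · simp [bump_eq_zero hws hu0 u hx]
  have hJ0 : 0 < J := by linarith
  have h4 : ‖logError χ u‖ * J ≤ κ + c * J := by
    calc ‖logError χ u‖ * J = ‖logError χ u * J‖ := by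
          rw [norm_mul, norm_real, Real.norm_of_nonneg hJ0.le]
      _ ≤ _ := by rw [hkey]; exact (norm_sub_le _ _).trans (add_le_add h3 hrem)
  have h5 : ‖logError χ u‖ ≤ κ / J + c := by
    rw [← sub_le_iff_le_add, le_div_iff₀ hJ0]; linarith
  calc _ ≤ κ / J + c := h5
    _ ≤ κ / u + c := by gcongr
    _ = _ := by rw [hc]; ring

end Tauberian

section PartialSums

lemma regPart_zero_of_ne_one {q : ℕ} [NeZero q] {χ : DirichletCharacter ℂ q} (h : χ ≠ 1) :
    regPart χ 0 = -(deriv (LFunction χ) 1 / LFunction χ 1) := by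
  simp [regPart, entireL, h]

lemma LFunctionTrivChar₁_eq_prod_mul (q : ℕ) [NeZero q] (s : ℂ) :
    LFunctionTrivChar₁ q s =
      (∏ p ∈ q.primeFactors, (1 - (p : ℂ) ^ (-s))) * LFunctionTrivChar₁ 1 s := by
  rcases eq_or_ne s 1 with rfl | h
  · simp [LFunctionTrivChar₁, cpow_neg_one]
  · simp only [LFunctionTrivChar₁, Function.update_of_ne h, LFunctionTrivChar_eq_mul_riemannZeta h]
    simp
    ring

lemma regPart_one_sub_regPart_one (q : ℕ) [NeZero q] :
    regPart (1 : DirichletCharacter ℂ 1) 0 - regPart (1 : DirichletCharacter ℂ q) 0 =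
      ((∑ p ∈ q.primeFactors, Real.log p / ((p : ℝ) - 1) : ℝ) : ℂ) := by
  have he (N : ℕ) [NeZero N] : regPart (1 : DirichletCharacter ℂ N) 0 =
      -logDeriv (LFunctionTrivChar₁ N) 1 := by
    simp [regPart, entireL, logDeriv_apply]
  have hd (p : ℕ) (hp : p ∈ q.primeFactors) :
      HasDerivAt (fun s : ℂ ↦ 1 - (p : ℂ) ^ (-s)) ((Real.log p : ℂ) * (p : ℂ)⁻¹) 1 := by
    have hp0 : (p : ℂ) ≠ 0 := by exact_mod_cast (Nat.prime_of_mem_primeFactors hp).ne_zero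
    refine (((hasDerivAt_neg (1 : ℂ)).const_cpow (.inl hp0)).const_sub 1).congr_deriv ?_
    rw [cpow_neg_one, ← natCast_log]
    ring
  have hne (p : ℕ) (hp : p ∈ q.primeFactors) : (1 : ℂ) - (p : ℂ) ^ (-(1 : ℂ)) ≠ 0 := by
    rw [cpow_neg_one, sub_ne_zero, ne_comm, Ne, inv_eq_one]
    exact_mod_cast (Nat.prime_of_mem_primeFactors hp).ne_one
  have h : LFunctionTrivChar₁ q =
      fun s ↦ (∏ p ∈ q.primeFactors, (1 - (p : ℂ) ^ (-s))) * LFunctionTrivChar₁ 1 s :=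
    funext (LFunctionTrivChar₁_eq_prod_mul q)
  rw [he, he, h, logDeriv_mul 1 (Finset.prod_ne_zero_iff.mpr hne)
    (LFunctionTrivChar₁_apply_one_ne_zero 1)
    (DifferentiableAt.fun_finsetProd fun p hp ↦ (hd p hp).differentiableAt)
    (differentiable_LFunctionTrivChar₁ 1 1),
    logDeriv_prod hne fun p hp ↦ (hd p hp).differentiableAt]
  push_cast
  rw [neg_sub_neg, add_sub_cancel_right]
  refine sum_congr rfl fun p hp ↦ ?_
  have hp0 : (p : ℂ) ≠ 0 := by exact_mod_cast (Nat.prime_of_mem_primeFactors hp).ne_zero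
  have hp1 : (p : ℂ) - 1 ≠ 0 := by
    rw [sub_ne_zero]; exact_mod_cast (Nat.prime_of_mem_primeFactors hp).ne_one
  rw [logDeriv_apply, (hd p hp).deriv, cpow_neg_one, natCast_log]
  field_simp

variable {q : ℕ} [NeZero q] (χ : DirichletCharacter ℂ q)

/-- Partial sums of `χ(n) Λ(n) / n` with error term. -/
lemma exists_norm_charSum_sub_le : ∃ C, 0 ≤ C ∧ ∀ y : ℝ, Real.exp 2 ≤ y →
    ‖charSum χ ⌊y⌋₊ - poleOrder χ * Real.log y - regPart χ 0‖ ≤ C / Real.log y := by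
  obtain ⟨C, hC, h⟩ := exists_norm_logError_le χ
  refine ⟨C, hC, fun y hy ↦ ?_⟩
  have hy0 : 0 < y := (Real.exp_pos 2).trans_le hy
  have h2 : 2 ≤ Real.log y := (Real.le_log_iff_exp_le hy0).mpr hy
  have := h _ h2
  rwa [logError, if_pos (by linarith), Real.exp_log hy0] at this

lemma exists_norm_charSum_sub_log_le : ∃ M, 0 ≤ M ∧ ∀ y : ℝ, 1 ≤ y →
    ‖charSum χ ⌊y⌋₊ - poleOrder χ * Real.log y‖ ≤ M := by
  obtain ⟨C, hC, h⟩ := exists_norm_charSum_sub_le χ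
  refine ⟨C + ‖regPart χ 0‖ + 8, by positivity, fun y hy ↦ ?_⟩
  have hy0 : 0 < y := by linarith
  have hl : 0 ≤ Real.log y := Real.log_nonneg hy
  rcases le_or_gt (Real.exp 2) y with h2 | h2
  · have h3 : 2 ≤ Real.log y := (Real.le_log_iff_exp_le hy0).mpr h2
    have h4 := h y h2
    have h5 := norm_add_le (charSum χ ⌊y⌋₊ - poleOrder χ * Real.log y - regPart χ 0) (regPart χ 0)
    rw [sub_add_cancel] at h5
    have h6 : C / Real.log y ≤ C := div_le_self hC (by linarith)
    linarith
  · have h3 : Real.log y < 2 := (Real.log_lt_iff_lt_exp hy0).mpr h2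
    have h4 := norm_charSum_floor_le χ hl
    rw [Real.exp_log hy0] at h4
    have h5 : ‖(poleOrder χ * Real.log y : ℂ)‖ ≤ 2 := by
      rw [norm_mul, norm_real, norm_real, Real.norm_eq_abs, Real.norm_of_nonneg hl]
      nlinarith [abs_poleOrder_le χ, abs_nonneg (poleOrder χ)]
    have h6 := norm_sub_le (charSum χ ⌊y⌋₊) (poleOrder χ * Real.log y : ℂ)
    have h7 := norm_nonneg (regPart χ 0)
    nlinarith

/-- Partial sums of `χ(n) Λ(n) log n / n`. -/
lemma exists_norm_sum_log_sub_le : ∃ M, 0 ≤ M ∧ ∀ y : ℝ, 1 ≤ y →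
    ‖∑ n ∈ Icc 1 ⌊y⌋₊, χ n * (ArithmeticFunction.vonMangoldt n : ℂ) / n * Real.log n -
      poleOrder χ / 2 * Real.log y ^ 2‖ ≤ M * Real.log y := by
  obtain ⟨M, hM, h⟩ := exists_norm_charSum_sub_log_le χ
  refine ⟨2 * M, by positivity, fun y hy ↦ ?_⟩
  have hy0 : 0 < y := by linarith
  have hl : 0 ≤ Real.log y := Real.log_nonneg hy
  set c : ℕ → ℂ := fun n ↦ χ n * (ArithmeticFunction.vonMangoldt n : ℂ) / n with hc
  have hc0 : c 0 = 0 := by simp [hc]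
  have hIcc (N : ℕ) (f : ℕ → ℂ) (hf : f 0 = 0) : ∑ n ∈ Icc 0 N, f n = ∑ n ∈ Icc 1 N, f n := by
    rw [← Finset.insert_Icc_add_one_left_eq_Icc N.zero_le, sum_insert (by simp), hf, zero_add, zero_add]
  have hderiv : ∀ t ∈ Set.Icc 1 y, HasDerivAt (fun t : ℝ ↦ (Real.log t : ℂ)) ((t⁻¹ : ℝ) : ℂ) t :=
    fun t ht ↦ (Real.hasDerivAt_log (by linarith [ht.1] : t ≠ 0)).ofReal_comp
  have hcont : ContinuousOn (fun t : ℝ ↦ ((t⁻¹ : ℝ) : ℂ)) (Set.Icc 1 y) :=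
    continuous_ofReal.comp_continuousOn
      (continuousOn_inv₀.mono fun t ht ↦ by
        have := ht.1
        simp only [Set.mem_compl_iff, Set.mem_singleton_iff]
        linarith)
  have hint : IntegrableOn (deriv fun t : ℝ ↦ (Real.log t : ℂ)) (Set.Icc 1 y) :=
    (hcont.integrableOn_Icc).congr_fun (fun t ht ↦ (hderiv t ht).deriv.symm) measurableSet_Icc
  have habel := sum_mul_eq_sub_integral_mul₀ c hc0 y (f := fun t : ℝ ↦ (Real.log t : ℂ))
    (fun t ht ↦ (hderiv t ht).differentiableAt) hint
  rw [hIcc _ _ (by simp), hIcc _ _ hc0] at habel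
  have hlogc : ContinuousOn (fun t : ℝ ↦ (Real.log t : ℂ)) (Set.Icc 1 y) := fun t ht ↦
    (hderiv t ht).continuousAt.continuousWithinAt
  have hreal : IntegrableOn (fun t : ℝ ↦ M * t⁻¹) (Set.Ioc 1 y) :=
    ((continuousOn_const.mul (continuousOn_inv₀.mono fun t ht ↦ (by
      have := ht.1
      simp only [Set.mem_compl_iff, Set.mem_singleton_iff]
      linarith))).integrableOn_Icc).mono_set Set.Ioc_subset_Icc_self
  have hbd : ∀ t ∈ Set.Ioc 1 y,
      ‖((t⁻¹ : ℝ) : ℂ) * (charSum χ ⌊t⌋₊ - poleOrder χ * Real.log t)‖ ≤ M * t⁻¹ := fun t ht ↦ by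
    have ht0 : 0 < t := by linarith [ht.1]
    rw [norm_mul, norm_real, Real.norm_of_nonneg (by positivity), mul_comm]
    gcongr
    exact h t ht.1.le
  have hI1 : IntegrableOn
      (fun t : ℝ ↦ ((t⁻¹ : ℝ) : ℂ) * (charSum χ ⌊t⌋₊ - poleOrder χ * Real.log t))
      (Set.Ioc 1 y) := by
    refine Integrable.mono' hreal (Measurable.aestronglyMeasurable ?_)
      ((ae_restrict_iff' measurableSet_Ioc).mpr (Eventually.of_forall hbd))
    have : Measurable fun t : ℝ ↦ charSum χ ⌊t⌋₊ :=
      (measurable_from_nat (f := charSum χ)).comp Nat.measurable_floor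
    fun_prop
  have hI2 : IntegrableOn (fun t : ℝ ↦ ((t⁻¹ : ℝ) : ℂ) * (poleOrder χ * Real.log t))
      (Set.Ioc 1 y) :=
    ((hcont.mul (continuousOn_const.mul hlogc)).integrableOn_Icc).mono_set Set.Ioc_subset_Icc_self
  have hI2v : ∫ t in Set.Ioc 1 y, ((t⁻¹ : ℝ) : ℂ) * (poleOrder χ * Real.log t) =
      poleOrder χ / 2 * Real.log y ^ 2 := by
    rw [← intervalIntegral.integral_of_le hy,
      intervalIntegral.integral_eq_sub_of_hasDerivAt
        (f := fun t : ℝ ↦ (poleOrder χ / 2 * Real.log t ^ 2 : ℂ)) (fun t ht ↦ ?_)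
        ((intervalIntegrable_iff_integrableOn_Ioc_of_le hy).mpr hI2)]
    · simp
    · rw [Set.uIcc_of_le hy] at ht
      refine (((hderiv t ht).pow 2).const_mul _).congr_deriv ?_
      push_cast
      ring
  have hsplit : ∫ t in Set.Ioc 1 y, deriv (fun t : ℝ ↦ (Real.log t : ℂ)) t *
        ∑ n ∈ Icc 0 ⌊t⌋₊, c n =
      (∫ t in Set.Ioc 1 y, ((t⁻¹ : ℝ) : ℂ) * (charSum χ ⌊t⌋₊ - poleOrder χ * Real.log t)) +
        poleOrder χ / 2 * Real.log y ^ 2 := by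
    rw [← hI2v, ← integral_add hI1 hI2]
    refine setIntegral_congr_fun measurableSet_Ioc fun t ht ↦ ?_
    rw [(hderiv t (Set.Ioc_subset_Icc_self ht)).deriv, hIcc _ _ hc0, charSum]
    ring
  have hIb : ‖∫ t in Set.Ioc 1 y,
      ((t⁻¹ : ℝ) : ℂ) * (charSum χ ⌊t⌋₊ - poleOrder χ * Real.log t)‖ ≤ M * Real.log y := by
    refine (norm_integral_le_of_norm_le hreal
      ((ae_restrict_iff' measurableSet_Ioc).mpr (Eventually.of_forall hbd))).trans (le_of_eq ?_)
    rw [← intervalIntegral.integral_of_le hy, intervalIntegral.integral_const_mul,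
      integral_inv_of_pos one_pos hy0, div_one]
  have hbdry : ‖(Real.log y : ℂ) * (charSum χ ⌊y⌋₊ - poleOrder χ * Real.log y)‖ ≤
      M * Real.log y := by
    rw [norm_mul, norm_real, Real.norm_of_nonneg hl, mul_comm]
    gcongr
    exact h y hy
  have hfin : ∑ n ∈ Icc 1 ⌊y⌋₊, c n * Real.log n - poleOrder χ / 2 * Real.log y ^ 2 =
      (Real.log y : ℂ) * (charSum χ ⌊y⌋₊ - poleOrder χ * Real.log y) -
      ∫ t in Set.Ioc 1 y, ((t⁻¹ : ℝ) : ℂ) * (charSum χ ⌊t⌋₊ - poleOrder χ * Real.log t) := by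
    have : ∑ n ∈ Icc 1 ⌊y⌋₊, c n * Real.log n = ∑ n ∈ Icc 1 ⌊y⌋₊, (Real.log n : ℂ) * c n :=
      sum_congr rfl fun n _ ↦ mul_comm _ _
    rw [this, habel, hsplit, charSum]
    ring
  calc _ = ‖_‖ := congrArg norm hfin
    _ ≤ M * Real.log y + M * Real.log y := (norm_sub_le _ _).trans (add_le_add hbdry hIb)
    _ = _ := by ring

/-- Prime powers with exponent at least two contribute a convergent series. -/
lemma summable_not_prime_vonMangoldt :
    Summable fun n : ℕ ↦ (if n.Prime then 0 else ArithmeticFunction.vonMangoldt n) *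
      (n : ℝ) ^ (-(3 / 4) : ℝ) := by
  have h := LSeriesSummable_of_sum_norm_bigO
    (f := fun n ↦ ((if n.Prime then 0 else ArithmeticFunction.vonMangoldt n : ℝ) : ℂ))
    (r := 3 / 5) (s := 3 / 4) ?_ (by norm_num) (by norm_num)
  · refine h.norm.congr fun n ↦ ?_
    rcases eq_or_ne n 0 with rfl | hn
    · simp
    have hn0 : (0 : ℝ) < n := by exact_mod_cast Nat.pos_of_ne_zero hn
    have h0 : (0 : ℝ) ≤ if n.Prime then 0 else ArithmeticFunction.vonMangoldt n := by
      split_ifs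
      exacts [le_rfl, ArithmeticFunction.vonMangoldt_nonneg]
    rw [LSeries.term_of_ne_zero hn, norm_div, norm_real, Real.norm_of_nonneg h0,
      norm_natCast_cpow_of_pos (Nat.pos_of_ne_zero hn), Real.rpow_neg hn0.le, div_eq_mul_inv]
    norm_num
  · have h1 : (fun N : ℕ ↦ 2 * √(N : ℝ) * Real.log N) =O[atTop] fun N ↦ (N : ℝ) ^ (3 / 5 : ℝ) := by
      have h2 := (isLittleO_log_rpow_atTop (r := 1 / 10) (by norm_num)).isBigO
      have h3 : (fun x : ℝ ↦ 2 * √x * Real.log x) =O[atTop] fun x ↦ x ^ (3 / 5 : ℝ) := by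
        refine (((isBigO_refl (fun x : ℝ ↦ √x) atTop).const_mul_left 2).mul h2).trans
          (EventuallyEq.isBigO ?_)
        filter_upwards [eventually_gt_atTop 0] with x hx
        rw [Real.sqrt_eq_rpow, ← Real.rpow_add hx]
        norm_num
      exact h3.comp_tendsto tendsto_natCast_atTop_atTop
    refine (IsBigO.of_bound 1 ?_).trans h1
    filter_upwards [eventually_ge_atTop 1] with N hN
    have hN1 : (1 : ℝ) ≤ N := by exact_mod_cast hN
    have h2 := Chebyshev.psi_sub_theta_le hN1
    rw [Chebyshev.psi_sub_theta_eq_sum_not_prime, Nat.floor_natCast, sum_filter] at h2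
    rw [one_mul, Real.norm_of_nonneg (sum_nonneg fun _ _ ↦ norm_nonneg _)]
    refine le_trans (le_of_eq ?_) (h2.trans (Real.le_norm_self _))
    refine sum_congr rfl fun n _ ↦ ?_
    rw [norm_real, Real.norm_of_nonneg]
    · split_ifs <;> simp_all
    · split_ifs
      exacts [le_rfl, ArithmeticFunction.vonMangoldt_nonneg]

lemma exists_sum_not_prime_le : ∃ K, 0 ≤ K ∧ ∀ (s : Finset ℕ) (v : ℝ), 0 < v →
    (∀ n ∈ s, ¬ n.Prime ∧ v ≤ Real.log n) →
    ∑ n ∈ s, ArithmeticFunction.vonMangoldt n / n ≤ K / v := by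
  have hs := summable_not_prime_vonMangoldt
  have hnn : ∀ n : ℕ, 0 ≤ (if n.Prime then 0 else ArithmeticFunction.vonMangoldt n) *
      (n : ℝ) ^ (-(3 / 4) : ℝ) := fun n ↦ by
    split_ifs
    · simp
    · exact mul_nonneg ArithmeticFunction.vonMangoldt_nonneg (by positivity)
  refine ⟨4 * ∑' n : ℕ, (if n.Prime then 0 else ArithmeticFunction.vonMangoldt n) *
      (n : ℝ) ^ (-(3 / 4) : ℝ), mul_nonneg (by norm_num) (tsum_nonneg hnn), fun s v hv h ↦ ?_⟩
  rw [mul_comm 4, mul_div_assoc]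
  refine le_trans ?_ (mul_le_mul_of_nonneg_right (hs.sum_le_tsum s fun n _ ↦ hnn n)
    (by positivity))
  rw [sum_mul]
  refine sum_le_sum fun n hn ↦ ?_
  obtain ⟨h1, h2⟩ := h n hn
  have hn0 : (0 : ℝ) < n := by
    rcases Nat.eq_zero_or_pos n with rfl | h0
    · simp at h2; linarith
    · exact_mod_cast h0
  rw [if_neg h1, mul_assoc, div_eq_mul_inv]
  refine mul_le_mul_of_nonneg_left ?_ ArithmeticFunction.vonMangoldt_nonneg
  have h3 : (n : ℝ)⁻¹ = (n : ℝ) ^ (-(3 / 4) : ℝ) * (n : ℝ) ^ (-(1 / 4) : ℝ) := by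
    rw [← Real.rpow_add hn0, ← Real.rpow_neg_one]
    norm_num
  rw [h3]
  gcongr
  rw [Real.rpow_def_of_pos hn0, le_div_iff₀ hv]
  have h4 : Real.log n / 4 * Real.exp (-(Real.log n / 4)) ≤ 1 := by
    rw [Real.exp_neg, ← div_eq_mul_inv, div_le_one (Real.exp_pos _)]
    linarith [Real.add_one_le_exp (Real.log n / 4)]
  have h5 := Real.exp_pos (-(Real.log n / 4))
  have h6 : Real.log n * (-(1 / 4)) = -(Real.log n / 4) := by ring
  rw [h6]
  nlinarith

end PartialSums

section ExponentialSums

/-- An exponential sum with small frequencies vanishes near the zero of its linearisation. -/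
lemma exists_sum_mul_exp_eq_zero (P : ℂ) (D A : ℝ) (hD : D ≠ 0) (hA : 0 ≤ A)
    (hPD : 0 < (P / D).re) : ∃ C, 0 < C ∧ ∃ L₀ : ℝ, ∀ L : ℝ, L₀ ≤ L →
    ∀ (S : Finset ℕ) (a : ℕ → ℂ) (l : ℕ → ℝ), (∀ n ∈ S, 0 ≤ l n ∧ l n ≤ L) →
      ‖∑ n ∈ S, a n - P‖ ≤ A / L → ‖∑ n ∈ S, a n * l n - D / 2 * L ^ 2‖ ≤ A * L →
      ∑ n ∈ S, ‖a n‖ ≤ A * L →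
      ∃ w : ℂ, ∑ n ∈ S, a n * cexp (-(w * l n)) = 0 ∧ 0 < w.re ∧
        ‖w - 2 * P / (D * L ^ 2)‖ ≤ C / L ^ 3 := by
  set K : ℝ := 2 * (‖P‖ / |D|) + 1 with hK
  set A' : ℝ := A * (1 + K + K ^ 2) + 1 with hA'
  set C : ℝ := 12 * A' / |D| with hC
  have hD0 : 0 < |D| := abs_pos.mpr hD
  have hK0 : 0 < K := by positivity
  have hA0 : 0 < A' := by positivity
  have hC0 : 0 < C := by positivity
  set ρ : ℝ := (P / D).re with hρ
  refine ⟨C, hC0, 1 + K + C + C / ρ, fun L hL S a l hl h0 h1 h2 ↦ ?_⟩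
  have hCρ : 0 < C / ρ := by positivity
  have hL0 : 0 < L := by linarith
  have hLK : K ≤ L := by linarith
  have hLC : C ≤ L := by linarith
  have hLρ : C < ρ * L := by
    rw [mul_comm, ← div_lt_iff₀ hPD]; linarith
  set F : ℂ → ℂ := fun w ↦ ∑ n ∈ S, a n * cexp (-(w * l n)) with hF
  have hFd : Differentiable ℂ F := by
    refine Differentiable.fun_sum fun n _ ↦ ?_
    fun_prop
  have hmain (w : ℂ) (hw : ‖w‖ ≤ K / L ^ 2) : ‖F w - (P - w * (D / 2 * L ^ 2))‖ ≤ A' / L := by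
    have e : F w - (P - w * (D / 2 * L ^ 2)) =
        (∑ n ∈ S, a n * (cexp (-(w * l n)) - 1 - -(w * l n))) + (∑ n ∈ S, a n - P) -
          w * (∑ n ∈ S, a n * l n - D / 2 * L ^ 2) := by
      have : ∑ n ∈ S, a n * (cexp (-(w * l n)) - 1 - -(w * l n)) =
          F w - ∑ n ∈ S, a n + w * ∑ n ∈ S, a n * l n := by
        rw [hF, mul_sum, ← sum_sub_distrib, ← sum_add_distrib]
        exact sum_congr rfl fun n _ ↦ by ring
      rw [this]; ring
    have b1 : ‖∑ n ∈ S, a n * (cexp (-(w * l n)) - 1 - -(w * l n))‖ ≤ A * L * (K / L) ^ 2 := by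
      refine (norm_sum_le _ _).trans ((sum_le_sum fun n hn ↦ ?_).trans
        ((sum_mul S (fun n ↦ ‖a n‖) ((K / L) ^ 2)).symm.le.trans
        (mul_le_mul_of_nonneg_right h2 (sq_nonneg _))))
      rw [norm_mul]
      refine mul_le_mul_of_nonneg_left ?_ (norm_nonneg _)
      have h3 : ‖-(w * l n)‖ ≤ K / L := by
        rw [norm_neg, norm_mul, norm_real, Real.norm_of_nonneg (hl n hn).1]
        calc ‖w‖ * l n ≤ K / L ^ 2 * L := by
              have := (hl n hn).2
              have := (hl n hn).1
              gcongr
          _ = K / L := by field_simp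
      have h4 : K / L ≤ 1 := (div_le_one hL0).mpr hLK
      exact (norm_exp_sub_one_sub_id_le (h3.trans h4)).trans (by gcongr)
    have b2 : ‖w * (∑ n ∈ S, a n * l n - D / 2 * L ^ 2)‖ ≤ K / L ^ 2 * (A * L) := by
      rw [norm_mul]; gcongr
    rw [e]
    calc _ ≤ A * L * (K / L) ^ 2 + A / L + K / L ^ 2 * (A * L) :=
          (norm_sub_le _ _).trans (add_le_add ((norm_add_le _ _).trans (add_le_add b1 h0)) b2)
      _ = (A * (1 + K + K ^ 2)) / L := by field_simp; ring
      _ ≤ A' / L := by rw [hA']; gcongr; linarith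
  set w₀ : ℂ := 2 * P / (D * L ^ 2) with hw₀
  set r : ℝ := C / L ^ 3 with hr
  have hr0 : 0 < r := by positivity
  have hDc : (D : ℂ) ≠ 0 := ofReal_ne_zero.mpr hD
  have hLc : (L : ℂ) ≠ 0 := ofReal_ne_zero.mpr hL0.ne'
  have hw₀n : ‖w₀‖ = 2 * (‖P‖ / |D|) / L ^ 2 := by
    rw [hw₀, norm_div, norm_mul, norm_mul, norm_pow, norm_real, norm_real, Real.norm_eq_abs,
      Real.norm_of_nonneg hL0.le]
    simp
    field_simp
  have hin (w : ℂ) (hw : ‖w - w₀‖ ≤ r) : ‖w‖ ≤ K / L ^ 2 := by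
    have h3 : r ≤ 1 / L ^ 2 := by
      rw [hr, div_le_div_iff₀ (by positivity) (by positivity), one_mul]
      calc C * L ^ 2 ≤ L * L ^ 2 := by gcongr
        _ = _ := by ring
    have h4 := norm_add_le (w - w₀) w₀
    rw [sub_add_cancel, hw₀n] at h4
    rw [hK, add_div]
    linarith
  have hzero : P - w₀ * (D / 2 * L ^ 2) = 0 := by
    rw [hw₀]; field_simp; ring
  have hF0 : ‖F w₀‖ ≤ A' / L := by
    have := hmain w₀ (hin w₀ (by simpa using hr0.le))
    rwa [hzero, sub_zero] at this
  have hsph : ∀ z ∈ Metric.sphere w₀ r, 4 * A' / L ≤ ‖F z - F w₀‖ := fun z hz ↦ by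
    have hz' : ‖z - w₀‖ = r := by rwa [mem_sphere_iff_norm] at hz
    have h3 := hmain z (hin z hz'.le)
    have h4 : ‖(z - w₀) * (D / 2 * L ^ 2)‖ = 6 * A' / L := by
      rw [norm_mul, hz', norm_mul, norm_div, norm_pow, norm_real, norm_real, Real.norm_eq_abs,
        Real.norm_of_nonneg hL0.le, hr, hC]
      simp
      field_simp
      ring
    have h5 : (z - w₀) * (D / 2 * L ^ 2) =
        -((F z - F w₀) - (F z - (P - z * (D / 2 * L ^ 2))) + F w₀) := by
      linear_combination hzero
    have h6 : ‖(z - w₀) * (D / 2 * L ^ 2)‖ ≤ ‖F z - F w₀‖ + A' / L + A' / L := by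
      rw [h5, norm_neg]
      exact (norm_add_le _ _).trans
        (add_le_add ((norm_sub_le _ _).trans (add_le_add le_rfl h3)) hF0)
    rw [h4] at h6
    have h7 : 6 * A' / L = 6 * (A' / L) := by ring
    have h8 : 4 * A' / L = 4 * (A' / L) := by ring
    linarith
  have hAL : 0 < A' / L := by positivity
  have hfreq : ∃ᶠ z in 𝓝 w₀, F z ≠ F w₀ := by
    intro hcon
    simp only [not_not] at hcon
    have heq : F = fun _ ↦ F w₀ :=
      AnalyticOnNhd.eq_of_eventuallyEq (hFd.differentiableOn.analyticOnNhd isOpen_univ)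
        analyticOnNhd_const hcon
    have h3 : w₀ + r ∈ Metric.sphere w₀ r := by simp [hr0.le]
    have h4 := hsph _ h3
    rw [heq] at h4
    simp only [sub_self, norm_zero] at h4
    have h8 : 4 * A' / L = 4 * (A' / L) := by ring
    linarith
  have himg := hFd.diffContOnCl.ball_subset_image_closedBall hr0 hsph hfreq
  have h0m : (0 : ℂ) ∈ Metric.ball (F w₀) (4 * A' / L / 2) := by
    rw [mem_ball_iff_norm, zero_sub, norm_neg]
    have h8 : 4 * A' / L / 2 = 2 * (A' / L) := by ring
    linarith
  obtain ⟨w, hw, hw0⟩ := himg h0m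
  rw [mem_closedBall_iff_norm] at hw
  refine ⟨w, hw0, ?_, hw⟩
  have h3 := (abs_le.mp ((abs_re_le_norm (w - w₀)).trans hw)).1
  have h4 : w₀.re = 2 * ρ / L ^ 2 := by
    have : w₀ = ((2 / L ^ 2 : ℝ) : ℂ) * (P / D) := by
      rw [hw₀]; push_cast; field_simp
    rw [this, re_ofReal_mul]; ring
  rw [sub_re, h4] at h3
  have h5 : r < 2 * ρ / L ^ 2 := by
    rw [hr, div_lt_div_iff₀ (by positivity) (by positivity)]
    have : C * L ^ 2 < ρ * L * L ^ 2 := by gcongr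
    nlinarith [pow_pos hL0 3, mul_pos hPD (pow_pos hL0 3)]
  linarith

end ExponentialSums

section ModelCoefficients

lemma one_apply_modOne (n : ℕ) : (1 : DirichletCharacter ℂ 1) n = 1 :=
  MulChar.one_apply (isUnit_of_subsingleton _)

open Classical in
/-- A combination of truncated characters agreeing with the function `b` at primes. -/
noncomputable def modelCoeff {q : ℕ} (χ : DirichletCharacter ℂ q) (Y Z X : ℝ) (n : ℕ) : ℂ :=
  (1 : DirichletCharacter ℂ 1) n - 2 * (1 : DirichletCharacter ℂ q) n +
    (if (n : ℝ) ≤ Y then χ n + (1 : DirichletCharacter ℂ q) n else 0) -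
    (if (n : ℝ) ≤ Z then 2 * (1 : DirichletCharacter ℂ q) n else 0) +
    (if (n : ℝ) ≤ X then 2 * (1 : DirichletCharacter ℂ q) n else 0)

/-- The partial sums `∑ χ(n) Λ(n) f(n) / n`. -/
noncomputable def weightedSum {q : ℕ} (χ : DirichletCharacter ℂ q) (f : ℕ → ℂ) (y : ℝ) : ℂ :=
  ∑ n ∈ Icc 1 ⌊y⌋₊, χ n * (ArithmeticFunction.vonMangoldt n : ℂ) / n * f n

lemma sum_ite_le_eq (g : ℕ → ℂ) {y x : ℝ} (hyx : y ≤ x) :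
    ∑ n ∈ Icc 1 ⌊x⌋₊, (if (n : ℝ) ≤ y then g n else 0) = ∑ n ∈ Icc 1 ⌊y⌋₊, g n := by
  rw [← sum_filter]
  refine sum_congr ?_ fun _ _ ↦ rfl
  ext n
  rw [mem_filter, mem_Icc, mem_Icc]
  constructor
  · rintro ⟨⟨h1, -⟩, h3⟩
    exact ⟨h1, Nat.le_floor h3⟩
  · rintro ⟨h1, h2⟩
    have h3 : (n : ℝ) ≤ y := (Nat.le_floor_iff' (by omega)).mp h2
    exact ⟨⟨h1, h2.trans (Nat.floor_mono hyx)⟩, h3⟩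

lemma norm_modelCoeff_le {q : ℕ} (χ : DirichletCharacter ℂ q) (Y Z X : ℝ) (n : ℕ) :
    ‖modelCoeff χ Y Z X n‖ ≤ 9 := by
  have h1 : ‖(1 : DirichletCharacter ℂ q) n‖ ≤ 1 := norm_le_one _ _
  have h2 : ‖2 * (1 : DirichletCharacter ℂ q) n‖ ≤ 2 := by
    rw [norm_mul]; norm_num; linarith
  have h3 : ‖χ n‖ ≤ 1 := norm_le_one _ _
  have h4 : ‖χ n + (1 : DirichletCharacter ℂ q) n‖ ≤ 2 := (norm_add_le _ _).trans (by linarith)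
  have h5 : ‖(1 : DirichletCharacter ℂ 1) n‖ ≤ 1 := norm_le_one _ _
  unfold modelCoeff
  refine (norm_add_le _ _).trans ?_
  have e1 : ‖(if (n : ℝ) ≤ X then 2 * (1 : DirichletCharacter ℂ q) n else 0)‖ ≤ 2 := by
    split_ifs
    exacts [h2, by simp]
  have e2 : ‖(if (n : ℝ) ≤ Z then 2 * (1 : DirichletCharacter ℂ q) n else 0)‖ ≤ 2 := by
    split_ifs
    exacts [h2, by simp]
  have e3 : ‖(if (n : ℝ) ≤ Y then χ n + (1 : DirichletCharacter ℂ q) n else 0)‖ ≤ 2 := by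
    split_ifs
    exacts [h4, by simp]
  have := (norm_sub_le _ _).trans (add_le_add ((norm_add_le _ _).trans
    (add_le_add ((norm_sub_le _ _).trans (add_le_add h5 h2)) e3)) e2)
  linarith

lemma sum_modelCoeff {q : ℕ} (χ : DirichletCharacter ℂ q) {Y Z X x : ℝ} (hY : Y ≤ x) (hZ : Z ≤ x)
    (hX : X ≤ x) (f : ℕ → ℂ) :
    ∑ n ∈ Icc 1 ⌊x⌋₊, (ArithmeticFunction.vonMangoldt n : ℂ) * modelCoeff χ Y Z X n / n * f n =
      weightedSum (1 : DirichletCharacter ℂ 1) f x -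
        2 * weightedSum (1 : DirichletCharacter ℂ q) f x +
        weightedSum χ f Y + weightedSum (1 : DirichletCharacter ℂ q) f Y -
        2 * weightedSum (1 : DirichletCharacter ℂ q) f Z +
        2 * weightedSum (1 : DirichletCharacter ℂ q) f X := by
  simp only [weightedSum]
  rw [← sum_ite_le_eq _ hY, ← sum_ite_le_eq _ hY, ← sum_ite_le_eq _ hZ, ← sum_ite_le_eq _ hX]
  simp only [mul_sum, ← sum_sub_distrib, ← sum_add_distrib]
  refine sum_congr rfl fun n _ ↦ ?_
  unfold modelCoeff
  split_ifs <;> ring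

section coefficients

variable {q : ℕ} {χ : DirichletCharacter ℂ q} {Y Z X x : ℝ} {b : ℕ → ℂ}
  (hYZ : Y ≤ Z) (hZX : Z ≤ X) (hXx : X ≤ x)
  (hb1 : b 1 = 1) (hbm : ∀ k n : ℕ, b (k * n) = b k * b n)
  (hb : ∀ p : ℕ, p.Prime →
    (p ∣ q → b p = 1) ∧
    ((p : ℝ) ≤ Y → ¬p ∣ q → b p = χ (p : ZMod q)) ∧
    (Y < (p : ℝ) → (p : ℝ) ≤ Z → b p = -1) ∧
    (Z < (p : ℝ) → (p : ℝ) ≤ X → b p = 1) ∧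
    (X < (p : ℝ) → (p : ℝ) ≤ x → b p = -1))

include hb1 hbm in
lemma apply_pow_eq (p k : ℕ) : b (p ^ k) = b p ^ k := by
  induction k with
  | zero => simpa using hb1
  | succ k ih => rw [pow_succ, pow_succ, hbm, ih]

include hYZ hZX hb in
lemma apply_prime_eq {p : ℕ} (hp : p.Prime) (hpx : (p : ℝ) ≤ x) :
    b p = modelCoeff χ Y Z X p := by
  obtain ⟨h1, h2, h3, h4, h5⟩ := hb p hp
  have := Fact.mk hp
  unfold modelCoeff
  rw [one_apply_modOne]
  by_cases hd : p ∣ q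
  · have hu : ¬ IsUnit (p : ZMod q) := fun h ↦ (ZMod.isUnit_prime_iff_not_dvd hp).mp h hd
    rw [h1 hd, MulChar.map_nonunit _ hu, MulChar.map_nonunit _ hu]
    simp
  · have hu : IsUnit (p : ZMod q) := (ZMod.isUnit_prime_iff_not_dvd hp).mpr hd
    rw [MulChar.one_apply hu]
    rcases le_or_gt (p : ℝ) Y with hY | hY
    · rw [if_pos hY, if_pos (hY.trans hYZ), if_pos (hY.trans (hYZ.trans hZX)), h2 hY hd]
      ring
    rw [if_neg hY.not_ge]
    rcases le_or_gt (p : ℝ) Z with hZ | hZ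
    · rw [if_pos hZ, if_pos (hZ.trans hZX), h3 hY hZ]
      norm_num
    rw [if_neg hZ.not_ge]
    rcases le_or_gt (p : ℝ) X with hX | hX
    · rw [if_pos hX, h4 hZ hX]
      norm_num
    · rw [if_neg hX.not_ge, h5 hX hpx]
      norm_num

include hYZ hZX hb1 hbm hb in
lemma apply_prime_pow_eq {p k : ℕ} (hp : p.Prime) (hk : k ≠ 0) (hpY : ((p ^ k : ℕ) : ℝ) ≤ Y) :
    b (p ^ k) = modelCoeff χ Y Z X (p ^ k) := by
  obtain ⟨h1, h2, -⟩ := hb p hp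
  unfold modelCoeff
  rw [one_apply_modOne, if_pos hpY, if_pos (hpY.trans hYZ), if_pos (hpY.trans (hYZ.trans hZX)),
    apply_pow_eq hb1 hbm]
  by_cases hd : p ∣ q
  · have hu : ¬ IsUnit ((p ^ k : ℕ) : ZMod q) := by
      rw [Nat.cast_pow, isUnit_pow_iff hk]
      exact fun h ↦ (ZMod.isUnit_prime_iff_not_dvd hp).mp h hd
    rw [h1 hd, MulChar.map_nonunit _ hu, MulChar.map_nonunit _ hu]
    simp
  · have hu : IsUnit ((p ^ k : ℕ) : ZMod q) := by
      rw [Nat.cast_pow, isUnit_pow_iff hk]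
      exact (ZMod.isUnit_prime_iff_not_dvd hp).mpr hd
    have hpY' : (p : ℝ) ≤ Y :=
      (Nat.cast_le.mpr (Nat.le_self_pow hk p)).trans hpY
    rw [MulChar.one_apply hu, h2 hpY' hd, Nat.cast_pow, map_pow]
    ring

include hb in
lemma norm_apply_prime_le {p : ℕ} (hp : p.Prime) (hpx : (p : ℝ) ≤ x) : ‖b p‖ ≤ 1 := by
  obtain ⟨h1, h2, h3, h4, h5⟩ := hb p hp
  by_cases hd : p ∣ q
  · simp [h1 hd]
  rcases le_or_gt (p : ℝ) Y with hY | hY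
  · rw [h2 hY hd]; exact norm_le_one _ _
  rcases le_or_gt (p : ℝ) Z with hZ | hZ
  · simp [h3 hY hZ]
  rcases le_or_gt (p : ℝ) X with hX | hX
  · simp [h4 hZ hX]
  · simp [h5 hX hpx]

include hb1 hbm hb in
lemma norm_apply_le {n : ℕ} (hn : IsPrimePow n) (hnx : (n : ℝ) ≤ x) : ‖b n‖ ≤ 1 := by
  obtain ⟨p, k, hp, hk, rfl⟩ := (isPrimePow_nat_iff n).mp hn
  rw [apply_pow_eq hb1 hbm, norm_pow]
  refine pow_le_one₀ (norm_nonneg _) (norm_apply_prime_le hb hp ?_)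
  exact (Nat.cast_le.mpr (Nat.le_self_pow hk.ne' p)).trans hnx

include hYZ hZX hb1 hbm hb in
lemma norm_sum_sub_sum_modelCoeff_le (f : ℕ → ℂ) {B : ℝ}
    (hf : ∀ n ∈ Icc 1 ⌊x⌋₊, ‖f n‖ ≤ B) :
    ‖∑ n ∈ Icc 1 ⌊x⌋₊, (ArithmeticFunction.vonMangoldt n : ℂ) * b n / n * f n -
      ∑ n ∈ Icc 1 ⌊x⌋₊, (ArithmeticFunction.vonMangoldt n : ℂ) * modelCoeff χ Y Z X n / n * f n‖ ≤
      10 * B * ∑ n ∈ (Icc 1 ⌊x⌋₊).filter fun n : ℕ ↦ ¬ n.Prime ∧ Y < n,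
        ArithmeticFunction.vonMangoldt n / n := by
  rw [← sum_sub_distrib, sum_filter, mul_sum]
  refine (norm_sum_le _ _).trans (sum_le_sum fun n hn ↦ ?_)
  have hn1 := (mem_Icc.mp hn).1
  have hnx : (n : ℝ) ≤ x := (Nat.le_floor_iff' (by omega)).mp (mem_Icc.mp hn).2
  have hnn : 0 ≤ ArithmeticFunction.vonMangoldt n := ArithmeticFunction.vonMangoldt_nonneg
  by_cases hpp : IsPrimePow n
  · split_ifs with h
    · have e : (ArithmeticFunction.vonMangoldt n : ℂ) * b n / n * f n -
          (ArithmeticFunction.vonMangoldt n : ℂ) * modelCoeff χ Y Z X n / n * f n =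
          (b n - modelCoeff χ Y Z X n) * f n *
            ((ArithmeticFunction.vonMangoldt n / n : ℝ) : ℂ) := by
        push_cast; ring
      rw [e, norm_mul, norm_real, Real.norm_of_nonneg (by positivity), norm_mul]
      gcongr
      · refine (norm_sub_le _ _).trans ?_
        linarith [norm_apply_le hb1 hbm hb hpp hnx, norm_modelCoeff_le χ Y Z X n]
      · exact hf n hn
    · have e : b n = modelCoeff χ Y Z X n := by
        rcases not_and_or.mp h with h1 | h1
        · exact apply_prime_eq hYZ hZX hb (not_not.mp h1) hnx
        · obtain ⟨p, k, hp, hk, rfl⟩ := (isPrimePow_nat_iff n).mp hpp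
          exact apply_prime_pow_eq hYZ hZX hb1 hbm hb hp hk.ne' (not_lt.mp h1)
      rw [e]; simp
  · rw [ArithmeticFunction.vonMangoldt_eq_zero_iff.mpr hpp]
    simp

end coefficients

end ModelCoefficients

section ModelSums

lemma norm_combination_le (a b c d e f : ℂ) :
    ‖a - 2 * b + c + d - 2 * e + 2 * f‖ ≤ ‖a‖ + 2 * ‖b‖ + ‖c‖ + ‖d‖ + 2 * ‖e‖ + 2 * ‖f‖ := by
  have h2 (z : ℂ) : ‖2 * z‖ = 2 * ‖z‖ := by simp
  rw [← h2 b, ← h2 e, ← h2 f]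
  exact (norm_add_le _ _).trans (add_le_add ((norm_sub_le _ _).trans (add_le_add
    ((norm_add_le _ _).trans (add_le_add ((norm_add_le _ _).trans (add_le_add (norm_sub_le _ _)
      le_rfl)) le_rfl)) le_rfl)) le_rfl)

lemma weightedSum_one {q : ℕ} (χ : DirichletCharacter ℂ q) (y : ℝ) :
    weightedSum χ (fun _ ↦ 1) y = charSum χ ⌊y⌋₊ := by
  simp [weightedSum, charSum]

variable {q : ℕ} [NeZero q] (χ : DirichletCharacter ℂ q)

/-- Partial sums of the model coefficients, divided by `n`. -/
lemma exists_norm_sum_modelCoeff_sub_le (hχ : χ ≠ 1) {δ ε : ℝ} (hε0 : 0 < ε) (hεδ : ε = 2 * δ - 1)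
    (hδ1 : δ < 1) {m : ℝ} (hm : 1 < m) : ∃ C, 0 ≤ C ∧ ∀ x : ℝ, 0 < x → 2 / ε ≤ Real.log x →
      m * x ^ ε ≤ x ^ δ →
      ‖∑ n ∈ Icc 1 ⌊x⌋₊, (ArithmeticFunction.vonMangoldt n : ℂ) *
          modelCoeff χ (x ^ ε) (m * x ^ ε) (x ^ δ) n / n -
        (regPart χ 0 + regPart (1 : DirichletCharacter ℂ 1) 0 -
          regPart (1 : DirichletCharacter ℂ q) 0 - 2 * Real.log m)‖ ≤ C / Real.log x := by
  obtain ⟨C, hC, h⟩ := exists_norm_charSum_sub_le χ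
  obtain ⟨C₀, hC₀, h₀⟩ := exists_norm_charSum_sub_le (1 : DirichletCharacter ℂ 1)
  obtain ⟨C₁, hC₁, h₁⟩ := exists_norm_charSum_sub_le (1 : DirichletCharacter ℂ q)
  have hp0 : poleOrder χ = 0 := by simp [poleOrder, hχ]
  have hp1 (N : ℕ) : poleOrder (1 : DirichletCharacter ℂ N) = 1 := by simp [poleOrder]
  refine ⟨(C + C₀ + 7 * C₁) / ε, by positivity, fun x hx hL hZX ↦ ?_⟩
  set L := Real.log x with hLdef
  have hlm : 0 < Real.log m := Real.log_pos hm
  have hεL : 2 ≤ ε * L := by rwa [div_le_iff₀' hε0] at hL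
  have hL0 : 0 < L := by
    by_contra hneg
    nlinarith
  have hεδ' : ε ≤ δ := by linarith
  have hx1 : 1 ≤ x := by
    by_contra hneg
    exact absurd (Real.log_neg hx (not_le.mp hneg)) (not_lt.mpr hL0.le)
  have hY : Real.log (x ^ ε) = ε * L := Real.log_rpow hx _
  have hX : Real.log (x ^ δ) = δ * L := Real.log_rpow hx _
  have hZ : Real.log (m * x ^ ε) = Real.log m + ε * L := by
    rw [Real.log_mul (by positivity) (by positivity), hY]
  have hXx : x ^ δ ≤ x := Real.rpow_le_self_of_one_le hx1 hδ1.le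
  have hYX : x ^ ε ≤ x ^ δ := Real.rpow_le_rpow_of_exponent_le hx1 hεδ'
  have hbig {y : ℝ} (hy : 0 < y) (h2 : ε * L ≤ Real.log y) : Real.exp 2 ≤ y :=
    (Real.le_log_iff_exp_le hy).mp (hεL.trans h2)
  have hfrac {c v : ℝ} (hc : 0 ≤ c) (hv : ε * L ≤ v) : c / v ≤ c / (ε * L) := by gcongr
  have hδL : ε * L ≤ δ * L := by gcongr
  have h1L : ε * L ≤ L := by nlinarith
  have hZL : ε * L ≤ Real.log m + ε * L := by linarith
  have e1 := (h₀ x (hbig hx h1L)).trans (hfrac hC₀ h1L)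
  have e2 := (h₁ x (hbig hx h1L)).trans (hfrac hC₁ h1L)
  have e3 := (h _ (hbig (by positivity) hY.ge)).trans (hfrac hC hY.ge)
  have e4 := (h₁ _ (hbig (by positivity) hY.ge)).trans (hfrac hC₁ hY.ge)
  have e5 := (h₁ _ (hbig (by positivity) (hZL.trans hZ.ge))).trans (hfrac hC₁ (hZL.trans hZ.ge))
  have e6 := (h₁ _ (hbig (by positivity) (hδL.trans hX.ge))).trans (hfrac hC₁ (hδL.trans hX.ge))
  have hsum := sum_modelCoeff χ (hYX.trans hXx) (hZX.trans hXx) hXx (fun _ ↦ 1)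
  simp only [mul_one, weightedSum_one] at hsum
  rw [hsum]
  have hcomb := norm_combination_le _ _ _ _ _ _ |>.trans (add_le_add (add_le_add (add_le_add
    (add_le_add (add_le_add e1 (mul_le_mul_of_nonneg_left e2 zero_le_two)) e3) e4)
    (mul_le_mul_of_nonneg_left e5 zero_le_two)) (mul_le_mul_of_nonneg_left e6 zero_le_two))
  rw [hp0, hp1, hp1, hX, hY, hZ, ← hLdef] at hcomb
  have hεc : (ε : ℂ) = 2 * δ - 1 := by rw [hεδ]; push_cast; ring
  refine le_trans (le_of_eq (congrArg norm ?_)) (hcomb.trans (le_of_eq ?_))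
  · push_cast
    rw [hεc]
    ring
  · field_simp
    ring

/-- Partial sums of the model coefficients, weighted by `log n / n`. -/
lemma exists_norm_sum_modelCoeff_mul_log_sub_le (hχ : χ ≠ 1) {δ ε : ℝ} (hε0 : 0 < ε)
    (hεδ : ε = 2 * δ - 1) (hδ1 : δ < 1) {m : ℝ} (hm : 1 < m) : ∃ C, 0 ≤ C ∧ ∀ x : ℝ, 0 < x →
      1 ≤ Real.log x → m * x ^ ε ≤ x ^ δ →
      ‖∑ n ∈ Icc 1 ⌊x⌋₊, (ArithmeticFunction.vonMangoldt n : ℂ) *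
          modelCoeff χ (x ^ ε) (m * x ^ ε) (x ^ δ) n / n * Real.log n -
        ((2 * δ ^ 2 - 1 - ε ^ 2 : ℝ) : ℂ) / 2 * Real.log x ^ 2‖ ≤ C * Real.log x := by
  obtain ⟨C, hC, h⟩ := exists_norm_sum_log_sub_le χ
  obtain ⟨C₀, hC₀, h₀⟩ := exists_norm_sum_log_sub_le (1 : DirichletCharacter ℂ 1)
  obtain ⟨C₁, hC₁, h₁⟩ := exists_norm_sum_log_sub_le (1 : DirichletCharacter ℂ q)
  have hp0 : poleOrder χ = 0 := by simp [poleOrder, hχ]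
  have hp1 (N : ℕ) : poleOrder (1 : DirichletCharacter ℂ N) = 1 := by simp [poleOrder]
  have hlm : 0 < Real.log m := Real.log_pos hm
  refine ⟨C + C₀ + 7 * C₁ + 2 * Real.log m + Real.log m ^ 2, by positivity,
    fun x hx hL hZX ↦ ?_⟩
  set L := Real.log x with hLdef
  have hL0 : 0 < L := by linarith
  have hεδ' : ε ≤ δ := by linarith
  have hx1 : 1 ≤ x := by
    by_contra hneg
    exact absurd (Real.log_neg hx (not_le.mp hneg)) (not_lt.mpr hL0.le)
  have hY : Real.log (x ^ ε) = ε * L := Real.log_rpow hx _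
  have hX : Real.log (x ^ δ) = δ * L := Real.log_rpow hx _
  have hZ : Real.log (m * x ^ ε) = Real.log m + ε * L := by
    rw [Real.log_mul (by positivity) (by positivity), hY]
  have hXx : x ^ δ ≤ x := Real.rpow_le_self_of_one_le hx1 hδ1.le
  have hYX : x ^ ε ≤ x ^ δ := Real.rpow_le_rpow_of_exponent_le hx1 hεδ'
  have hY1 : 1 ≤ x ^ ε := Real.one_le_rpow hx1 hε0.le
  have hZ1 : 1 ≤ m * x ^ ε := by nlinarith
  have hmul {y c : ℝ} (hc : 0 ≤ c) (hy : 0 < y) (hyx : y ≤ x) : c * Real.log y ≤ c * L := by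
    gcongr
    exact Real.log_le_log hy hyx
  have e1 := h₀ x hx1
  have e2 := h₁ x hx1
  have e3 := (h _ hY1).trans (hmul hC (by positivity) (hYX.trans hXx))
  have e4 := (h₁ _ hY1).trans (hmul hC₁ (by positivity) (hYX.trans hXx))
  have e5 := (h₁ _ hZ1).trans (hmul hC₁ (by positivity) (hZX.trans hXx))
  have e6 := (h₁ _ (hY1.trans hYX)).trans (hmul hC₁ (by positivity) hXx)
  have hsum := sum_modelCoeff χ (hYX.trans hXx) (hZX.trans hXx) hXx (fun n ↦ (Real.log n : ℂ))
  simp only [weightedSum] at hsum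
  rw [hsum]
  have hcomb := norm_combination_le _ _ _ _ _ _ |>.trans (add_le_add (add_le_add (add_le_add
    (add_le_add (add_le_add e1 (mul_le_mul_of_nonneg_left e2 zero_le_two)) e3) e4)
    (mul_le_mul_of_nonneg_left e5 zero_le_two)) (mul_le_mul_of_nonneg_left e6 zero_le_two))
  rw [hp0, hp1, hp1, hX, hY, hZ, ← hLdef] at hcomb
  have hεc : (ε : ℂ) = 2 * δ - 1 := by rw [hεδ]; push_cast; ring
  have hextra : ‖((2 * ε * L * Real.log m + Real.log m ^ 2 : ℝ) : ℂ)‖ ≤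
      (2 * Real.log m + Real.log m ^ 2) * L := by
    rw [norm_real, Real.norm_of_nonneg (by positivity), add_mul]
    refine add_le_add ?_ (le_mul_of_one_le_right (sq_nonneg _) hL)
    have : ε ≤ 1 := by linarith
    have : 0 < L * Real.log m := by positivity
    nlinarith
  have hfin := (norm_sub_le _ _).trans (add_le_add hcomb hextra)
  refine le_trans (le_of_eq (congrArg norm ?_)) (hfin.trans (le_of_eq ?_))
  · push_cast
    rw [hεc]
    ring
  · ring

end ModelSums

section Moments

variable {q : ℕ} [NeZero q] (χ : DirichletCharacter ℂ q)

/-- The zeroth, first and absolute logarithmic moments of `Λ(n) b(n) / n`. -/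
lemma exists_moment_bounds (hχ : χ ≠ 1) {δ ε : ℝ} (hε0 : 0 < ε)
    (hεδ : ε = 2 * δ - 1) (hδ1 : δ < 1) {m : ℝ} (hm : 1 < m) : ∃ A, 0 ≤ A ∧ ∀ x : ℝ, 0 < x →
      2 / ε ≤ Real.log x → 2 * Real.log m / (1 - ε) < Real.log x →
      ∀ b : ℕ → ℂ, b 1 = 1 → (∀ k n : ℕ, b (k * n) = b k * b n) →
      (∀ p : ℕ, p.Prime →
        (p ∣ q → b p = 1) ∧
        ((p : ℝ) ≤ x ^ ε → ¬p ∣ q → b p = χ (p : ZMod q)) ∧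
        (x ^ ε < (p : ℝ) → (p : ℝ) ≤ m * x ^ ε → b p = -1) ∧
        (m * x ^ ε < (p : ℝ) → (p : ℝ) ≤ x ^ δ → b p = 1) ∧
        (x ^ δ < (p : ℝ) → (p : ℝ) ≤ x → b p = -1)) →
      ‖∑ n ∈ Icc 1 ⌊x⌋₊, (ArithmeticFunction.vonMangoldt n : ℂ) * b n / n -
        (regPart χ 0 + regPart (1 : DirichletCharacter ℂ 1) 0 -
          regPart (1 : DirichletCharacter ℂ q) 0 - 2 * Real.log m)‖ ≤ A / Real.log x ∧
      ‖∑ n ∈ Icc 1 ⌊x⌋₊, (ArithmeticFunction.vonMangoldt n : ℂ) * b n / n * Real.log n -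
        ((2 * δ ^ 2 - 1 - ε ^ 2 : ℝ) : ℂ) / 2 * Real.log x ^ 2‖ ≤ A * Real.log x ∧
      ∑ n ∈ Icc 1 ⌊x⌋₊, ‖(ArithmeticFunction.vonMangoldt n : ℂ) * b n / n‖ ≤
        A * Real.log x := by
  obtain ⟨C₀, hC₀, h₀⟩ := exists_norm_sum_modelCoeff_sub_le χ hχ hε0 hεδ hδ1 hm
  obtain ⟨C₁, hC₁, h₁⟩ := exists_norm_sum_modelCoeff_mul_log_sub_le χ hχ hε0 hεδ hδ1 hm
  obtain ⟨M, hM, hψ⟩ := exists_norm_charSum_sub_log_le (1 : DirichletCharacter ℂ 1)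
  obtain ⟨K, hK, hpow⟩ := exists_sum_not_prime_le
  refine ⟨C₀ + C₁ + M + 1 + 10 * K / ε, by positivity, fun x hx hL hLm b hb1 hbm hb ↦ ?_⟩
  set L := Real.log x with hLdef
  have hKε : 0 ≤ 10 * K / ε := by positivity
  have hεL : 2 ≤ ε * L := by rwa [div_le_iff₀' hε0] at hL
  have hL1 : 1 ≤ L := by
    refine le_trans ?_ hL
    rw [le_div_iff₀ hε0]
    linarith
  have hL0 : 0 < L := by linarith
  have hx1 : 1 ≤ x := by
    by_contra hneg
    exact absurd (Real.log_neg hx (not_le.mp hneg)) (not_lt.mpr hL0.le)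
  have hY : Real.log (x ^ ε) = ε * L := Real.log_rpow hx _
  have hX : Real.log (x ^ δ) = δ * L := Real.log_rpow hx _
  have hXx : x ^ δ ≤ x := Real.rpow_le_self_of_one_le hx1 hδ1.le
  have hYZ : x ^ ε ≤ m * x ^ ε := le_mul_of_one_le_left (by positivity) hm.le
  have hZX : m * x ^ ε ≤ x ^ δ := by
    rw [← Real.log_le_log_iff (by positivity) (by positivity),
      Real.log_mul (by positivity) (by positivity), hY, hX]
    rw [div_lt_iff₀ (by linarith)] at hLm
    nlinarith
  have hlog {n : ℕ} (hn : n ∈ Icc 1 ⌊x⌋₊) : (n : ℝ) ≤ x ∧ 0 ≤ Real.log n ∧ Real.log n ≤ L := by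
    have hn1 := (mem_Icc.mp hn).1
    have hnx : (n : ℝ) ≤ x := (Nat.le_floor_iff' (by omega)).mp (mem_Icc.mp hn).2
    have : (0 : ℝ) < n := by exact_mod_cast hn1
    exact ⟨hnx, Real.log_natCast_nonneg n, Real.log_le_log this hnx⟩
  have hsmall : ∑ n ∈ (Icc 1 ⌊x⌋₊).filter fun n : ℕ ↦ ¬ n.Prime ∧ x ^ ε < n,
      ArithmeticFunction.vonMangoldt n / n ≤ K / (ε * L) := by
    refine hpow _ _ (by linarith) fun n hn ↦ ?_
    obtain ⟨-, h1, h2⟩ := mem_filter.mp hn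
    exact ⟨h1, hY.symm.le.trans (Real.log_le_log (by positivity) h2.le)⟩
  refine ⟨?_, ?_, ?_⟩
  · have h1 := norm_sum_sub_sum_modelCoeff_le hYZ hZX hb1 hbm hb (fun _ ↦ 1) (B := 1) (by simp)
    simp only [mul_one] at h1
    have h2 := norm_add_le_of_le (h1.trans (mul_le_mul_of_nonneg_left hsmall (by norm_num)))
      (h₀ x hx hL hZX)
    rw [sub_add_sub_cancel] at h2
    have h3 : 10 * (K / (ε * L)) + C₀ / L = (C₀ + 10 * K / ε) / L := by field_simp; ring
    refine h2.trans (h3.le.trans ?_)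
    gcongr
    linarith
  · have h1 := norm_sum_sub_sum_modelCoeff_le hYZ hZX hb1 hbm hb (fun n ↦ (Real.log n : ℂ))
      (B := L) (fun n hn ↦ by
        rw [norm_real, Real.norm_of_nonneg (hlog hn).2.1]
        exact (hlog hn).2.2)
    have h2 := norm_add_le_of_le (h1.trans (mul_le_mul_of_nonneg_left hsmall (by positivity)))
      (h₁ x hx hL1 hZX)
    rw [sub_add_sub_cancel] at h2
    have h3 : 10 * L * (K / (ε * L)) = 10 * K / ε := by field_simp
    rw [h3] at h2
    nlinarith
  · have h1 : ∑ n ∈ Icc 1 ⌊x⌋₊, ‖(ArithmeticFunction.vonMangoldt n : ℂ) * b n / n‖ ≤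
        ∑ n ∈ Icc 1 ⌊x⌋₊, ArithmeticFunction.vonMangoldt n / n := by
      refine sum_le_sum fun n hn ↦ ?_
      by_cases hpp : IsPrimePow n
      · have hnn : 0 ≤ ArithmeticFunction.vonMangoldt n := ArithmeticFunction.vonMangoldt_nonneg
        rw [norm_div, norm_mul, norm_real, Real.norm_of_nonneg hnn, _root_.norm_natCast]
        gcongr
        exact mul_le_of_le_one_right hnn (norm_apply_le hb1 hbm hb hpp (hlog hn).1)
      · simp [ArithmeticFunction.vonMangoldt_eq_zero_iff.mpr hpp]
    have h2 : charSum (1 : DirichletCharacter ℂ 1) ⌊x⌋₊ =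
        ((∑ n ∈ Icc 1 ⌊x⌋₊, ArithmeticFunction.vonMangoldt n / n : ℝ) : ℂ) := by
      rw [charSum]
      push_cast
      exact sum_congr rfl fun n _ ↦ by rw [one_apply_modOne, one_mul]
    have h3 := hψ x hx1
    rw [h2, ← ofReal_mul, ← ofReal_sub, norm_real, ← hLdef] at h3
    have h4 := (le_abs_self _).trans h3
    have hp1 : poleOrder (1 : DirichletCharacter ℂ 1) = 1 := by simp [poleOrder]
    rw [hp1] at h4
    nlinarith

end Moments

end WZero

/-- Lemma 5, second part: for all sufficiently large `x` (with `x^ε > q` and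
`log x > 2 log m/(1−ε)`), the auxiliary function `W_x(s) = ∑_{n ≤ x} Λ(n) b(n)/n^s` has a zero
`s` with `Re s > 1`, located at `1 + 2(S₁ − 2 log m)/((2δ²−1−ε²)(log x)²) + O(1/(log x)³)`. -/
theorem W_x_has_zero (q : ℕ) [NeZero q] (hq : 2 < q)
    (χ : DirichletCharacter ℂ q) (hχ : χ.IsPrimitive)
    (χbar : DirichletCharacter ℂ q) (hχbar : ∀ a : ZMod q, χbar a = starRingEnd ℂ (χ a))
    (δ : ℝ) (hδ : 1 / 2 < δ) (hδ' : δ < 1) (ε : ℝ) (hε : ε = 2 * δ - 1)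
    (S₁ : ℂ) (hS₁ : S₁ = -(deriv (LFunction χbar) 1 / LFunction χbar 1) +
      ((∑ p ∈ q.primeFactors, Real.log p / ((p : ℝ) - 1) : ℝ) : ℂ))
    (m : ℝ) (hm1 : 1 < m) (hm : 4 * Real.log m = S₁.re + 4 * ‖S₁‖ + 1) :
    ∃ C : ℝ, 0 < C ∧ ∃ x₀ : ℝ,
      ∀ x : ℝ, x₀ ≤ x → (q : ℝ) < x ^ ε → 2 * Real.log m / (1 - ε) < Real.log x →
        ∀ b : ℕ → ℂ, b 1 = 1 → (∀ k n : ℕ, b (k * n) = b k * b n) →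
          (∀ p : ℕ, p.Prime →
            (p ∣ q → b p = 1) ∧
            ((p : ℝ) ≤ x ^ ε → ¬p ∣ q → b p = χbar (p : ZMod q)) ∧
            (x ^ ε < (p : ℝ) → (p : ℝ) ≤ m * x ^ ε → b p = -1) ∧
            (m * x ^ ε < (p : ℝ) → (p : ℝ) ≤ x ^ δ → b p = 1) ∧
            (x ^ δ < (p : ℝ) → (p : ℝ) ≤ x → b p = -1)) →
          ∃ s : ℂ,
            (∑ n ∈ Finset.Icc 1 ⌊x⌋₊,
              (ArithmeticFunction.vonMangoldt n : ℂ) * b n / (n : ℂ) ^ s) = 0 ∧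
            1 < s.re ∧
            ‖s - (1 + 2 * (S₁ - 2 * (Real.log m : ℂ)) /
                (((2 * δ ^ 2 - 1 - ε ^ 2) * Real.log x ^ 2 : ℝ) : ℂ))‖ ≤
              C / Real.log x ^ 3 := by
  have hχbar1 : χbar ≠ 1 := by
    rintro rfl
    have h1 : χ = 1 := by
      ext a
      have := congrArg (starRingEnd ℂ) (hχbar a)
      rw [starRingEnd_self_apply] at this
      rw [← this, MulChar.one_apply_coe, map_one]
    rw [h1, DirichletCharacter.isPrimitive_def, DirichletCharacter.conductor_one] at hχ
    omega
  have hε0 : 0 < ε := by linarith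
  set D : ℝ := 2 * δ ^ 2 - 1 - ε ^ 2 with hD
  have hDneg : D < 0 := by
    have : D = -2 * (1 - δ) ^ 2 := by rw [hD, hε]; ring
    rw [this]
    nlinarith [pow_pos (sub_pos.mpr hδ') 2]
  have hS : WZero.regPart χbar 0 + WZero.regPart (1 : DirichletCharacter ℂ 1) 0 -
      WZero.regPart (1 : DirichletCharacter ℂ q) 0 = S₁ := by
    rw [add_sub_assoc, WZero.regPart_one_sub_regPart_one, WZero.regPart_zero_of_ne_one hχbar1, hS₁]
  set P : ℂ := S₁ - 2 * (Real.log m : ℂ) with hP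
  have hPD : 0 < (P / D).re := by
    rw [div_ofReal_re]
    refine div_pos_of_neg_of_neg ?_ hDneg
    have h1 : P.re = S₁.re - 2 * Real.log m := by
      rw [hP, sub_re, ← ofReal_ofNat, re_ofReal_mul, ofReal_re]
    have := re_le_norm S₁
    have := norm_nonneg S₁
    linarith
  obtain ⟨A, hA, hmom⟩ := WZero.exists_moment_bounds χbar hχbar1 hε0 hε hδ' hm1
  obtain ⟨C, hC, L₀, hzero⟩ := WZero.exists_sum_mul_exp_eq_zero P D A hDneg.ne hA hPD
  refine ⟨C, hC, Real.exp (max L₀ (2 / ε)), fun x hx _ hLm b hb1 hbm hb ↦ ?_⟩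
  have hx0 : 0 < x := (Real.exp_pos _).trans_le hx
  have hL := (Real.le_log_iff_exp_le hx0).mpr hx
  obtain ⟨h1, h2, h3⟩ := hmom x hx0 ((le_max_right _ _).trans hL) hLm b hb1 hbm hb
  rw [hS] at h1
  obtain ⟨w, hw0, hwre, hw⟩ := hzero (Real.log x) ((le_max_left _ _).trans hL) (Icc 1 ⌊x⌋₊)
    (fun n ↦ (ArithmeticFunction.vonMangoldt n : ℂ) * b n / n) (fun n ↦ Real.log n)
    (fun n hn ↦ by
      have hn1 := (mem_Icc.mp hn).1
      have hnx : (n : ℝ) ≤ x := (Nat.le_floor_iff' (by omega)).mp (mem_Icc.mp hn).2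
      exact ⟨Real.log_natCast_nonneg n, Real.log_le_log (by exact_mod_cast hn1) hnx⟩) h1 h2 h3
  refine ⟨1 + w, ?_, by simpa using hwre, ?_⟩
  · rw [← hw0]
    refine sum_congr rfl fun n hn ↦ ?_
    have hn0 : (n : ℂ) ≠ 0 := by
      have := (mem_Icc.mp hn).1
      exact_mod_cast (by omega : n ≠ 0)
    rw [cpow_add _ _ hn0, cpow_one, cpow_def_of_ne_zero hn0, Complex.exp_neg, natCast_log,
      mul_comm w]
    field_simp
  · rw [add_sub_add_left_eq_sub]
    push_cast at hw ⊢
    exact hw
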